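/- arXiv:math/0702800 — 4 statements merged into one kernel-verified Lean document; each statement's English description precedes it below -/
import Mathlib

section
/- For a,b ∈ X, all basic iterated integrals of positive order vanish at a*b^{-1} if and only if I_{i_1,…,i_k}(a) = I_{i_1,…,i_k}(b) for every multi-index (i_1,…,i_k) of positive integers. -/
open MeasureTheory

noncomputable section

/-- The class `X`: sequences `a = (a₁, a₂, …)` of bounded measurable functions on `[0,T]`
with `sup_{x,i} |aᵢ(x)|^{1/i} < ∞` (equivalently `‖aᵢ(x)‖ ≤ Cⁱ` for some `C`).
We index by `ℕ`, using only indices `i ≥ 1`. -/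
def MemX (T : ℝ) (a : ℕ → ℝ → ℂ) : Prop :=
  (∀ i, Measurable (a i)) ∧
    ∃ C : ℝ, ∀ i : ℕ, 1 ≤ i → ∀ x ∈ Set.Icc (0 : ℝ) T, ‖a i x‖ ≤ C ^ i

/-- Auxiliary iterated integral: for the multi-index list `[j₁, …, jₖ]` (outermost first),
`itIntAux a [j₁,…,jₖ] x = ∫_{0 ≤ s_k ≤ … ≤ s_1 ≤ x} a_{j₁}(s₁)⋯a_{jₖ}(sₖ) ds`. -/
def itIntAux (a : ℕ → ℝ → ℂ) : List ℕ → ℝ → ℂ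
  | [], _ => 1
  | i :: l, x => ∫ s in (0 : ℝ)..x, a i s * itIntAux a l s

/-- The basic iterated integral `I_{i₁,…,iₖ}(a)` over `0 ≤ s₁ ≤ ⋯ ≤ sₖ ≤ T`,
with the multi-index encoded as the list `[i₁, …, iₖ]` (so the empty list gives `1`). -/
def itInt (T : ℝ) (a : ℕ → ℝ → ℂ) (l : List ℕ) : ℂ :=
  itIntAux a l.reverse T

/-- The product `a * b` on `X`: traverse (rescaled) `b` on `[0, T/2]`, then `a`. -/
def starProd (T : ℝ) (a b : ℕ → ℝ → ℂ) : ℕ → ℝ → ℂ := fun i x =>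
  if x ≤ T / 2 then 2 * b i (2 * x) else 2 * a i (2 * x - T)

/-- The inverse `a⁻¹` on `X`: `(a⁻¹)ᵢ(x) = -aᵢ(T-x)`. -/
def invX (T : ℝ) (a : ℕ → ℝ → ℂ) : ℕ → ℝ → ℂ := fun i x => -(a i (T - x))

def convL (f g : List ℕ → ℂ) : List ℕ → ℂ
  | [] => f [] * g []
  | i :: l => f [] * g (i :: l) + convL (fun p => f (i :: p)) g l

lemma convL_sub (g : List ℕ → ℂ) (l : List ℕ) : ∀ f f' : List ℕ → ℂ,
    convL (fun p => f p - f' p) g l = convL f g l - convL f' g l := by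
  induction l with
  | nil => intro f f'; simp [convL, sub_mul]
  | cons i l ih => intro f f'; simp only [convL]; rw [ih]; ring

lemma convL_congr (g : List ℕ → ℂ) (l : List ℕ) (hl : ∀ i ∈ l, 1 ≤ i) :
    ∀ f f' : List ℕ → ℂ, (∀ p : List ℕ, (∀ i ∈ p, 1 ≤ i) → f p = f' p) →
    convL f g l = convL f' g l := by
  induction l with
  | nil => intro f f' h; simp [convL, h []]
  | cons i l ih =>
    intro f f' h
    simp only [convL]
    rw [ih (fun j hj => hl j (by simp [hj])) _ (fun p => f' (i :: p)), h [] (by simp)]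
    intro p hp
    apply h
    intro j hj
    rcases List.mem_cons.1 hj with rfl | hj
    · exact hl _ (by simp)
    · exact hp j hj

lemma convL_zero (g : List ℕ → ℂ) (hg : g [] = 1) (l : List ℕ) (hl : ∀ i ∈ l, 1 ≤ i) :
    ∀ h : List ℕ → ℂ, (∀ p : List ℕ, (∀ i ∈ p, 1 ≤ i) → convL h g p = 0) → h l = 0 := by
  induction l with
  | nil => intro h H; simpa [convL, hg] using H [] (by simp)
  | cons i l ih =>
    intro h H
    have h0 : h [] = 0 := by simpa [convL, hg] using H [] (by simp)
    apply ih (fun j hj => hl j (by simp [hj])) (fun p => h (i :: p))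
    intro p hp
    have := H (i :: p) (by
      intro j hj
      rcases List.mem_cons.1 hj with rfl | hj
      · exact hl _ (by simp)
      · exact hp j hj)
    simpa [convL, h0] using this

def Good (a : ℕ → ℝ → ℂ) : Prop :=
  ∀ i, Measurable (a i) ∧ ∃ C : ℝ, ∀ x, ‖a i x‖ ≤ C

lemma Good.ii {a : ℕ → ℝ → ℂ} (ha : Good a) (i : ℕ) {f : ℝ → ℂ} (hf : Continuous f)
    (x y : ℝ) : IntervalIntegrable (fun s => a i s * f s) volume x y := by
  obtain ⟨hm, C, hC⟩ := ha i
  have h1 : IntervalIntegrable f volume x y := hf.intervalIntegrable x y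
  rw [intervalIntegrable_iff] at h1 ⊢
  exact h1.bdd_mul hm.aestronglyMeasurable (Filter.Eventually.of_forall hC)

lemma Good.cont {a : ℕ → ℝ → ℂ} (ha : Good a) (l : List ℕ) : Continuous (itIntAux a l) := by
  induction l with
  | nil =>
    have : itIntAux a [] = fun _ => 1 := by ext x; simp [itIntAux]
    rw [this]; exact continuous_const
  | cons i l ih =>
    have : itIntAux a (i :: l) = fun x => ∫ s in (0 : ℝ)..x, a i s * itIntAux a l s := by
      ext x; simp [itIntAux]
    rw [this]
    exact intervalIntegral.continuous_primitive (fun x y => ha.ii i ih x y) 0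

lemma convL_cont (g : List ℕ → ℂ) (l : List ℕ) : ∀ A : List ℕ → ℝ → ℂ,
    (∀ p, Continuous (A p)) → Continuous (fun u => convL (fun p => A p u) g l) := by
  induction l with
  | nil => intro A hA; simp only [convL]; exact (hA _).mul continuous_const
  | cons i l ih =>
    intro A hA
    simp only [convL]
    exact ((hA _).mul continuous_const).add (ih (fun p => A (i :: p)) (fun p => hA _))

lemma convL_int {a : ℕ → ℝ → ℂ} (ha : Good a) (j : ℕ) (y : ℝ) (g : List ℕ → ℂ) (l : List ℕ) :
    ∀ A : List ℕ → ℝ → ℂ, (∀ p, Continuous (A p)) →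
    ∫ u in (0:ℝ)..y, a j u * convL (fun p => A p u) g l =
      convL (fun p => ∫ u in (0:ℝ)..y, a j u * A p u) g l := by
  induction l with
  | nil =>
    intro A hA
    simp only [convL, ← mul_assoc]
    exact intervalIntegral.integral_mul_const _ _
  | cons i l ih =>
    intro A hA
    simp only [convL, mul_add]
    rw [intervalIntegral.integral_add, ih (fun p => A (i :: p)) (fun p => hA _)]
    · congr 1
      simp only [← mul_assoc]
      exact intervalIntegral.integral_mul_const _ _
    · exact ha.ii j ((hA _).mul continuous_const) _ _
    · exact ha.ii j (convL_cont g l (fun p => A (i :: p)) (fun p => hA _)) _ _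

lemma Good.invX {a : ℕ → ℝ → ℂ} (ha : Good a) (T : ℝ) : Good (invX T a) := by
  intro i
  obtain ⟨hm, C, hC⟩ := ha i
  refine ⟨?_, C, fun x => ?_⟩
  · exact (hm.comp (measurable_const.sub measurable_id)).neg
  · simpa [_root_.invX] using hC (T - x)

lemma Good.star {a b : ℕ → ℝ → ℂ} (ha : Good a) (hb : Good b) (T : ℝ) :
    Good (starProd T a b) := by
  intro i
  obtain ⟨hm, C, hC⟩ := ha i
  obtain ⟨hm', C', hC'⟩ := hb i
  refine ⟨?_, max (2 * C) (2 * C'), fun x => ?_⟩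
  · unfold starProd
    refine Measurable.ite measurableSet_Iic ?_ ?_
    · exact (hm'.comp (measurable_id.const_mul 2)).const_mul 2
    · exact (hm.comp ((measurable_id.const_mul 2).sub_const T)).const_mul 2
  · unfold starProd
    split_ifs
    · refine le_max_of_le_right ?_
      simpa using hC' (2 * x)
    · refine le_max_of_le_left ?_
      simpa using hC (2 * x - T)

lemma inv_formula {b : ℕ → ℝ → ℂ} (hb : Good b) (T : ℝ) (l : List ℕ) : ∀ x,
    itIntAux b l (T - x) =
      convL (fun p => itIntAux (invX T b) p x) (fun q => itIntAux b q T) l := by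
  induction l with
  | nil => intro x; simp [convL, itIntAux]
  | cons i l ih =>
    intro x
    have hc := hb.invX T
    have key := convL_int hc i x (fun q => itIntAux b q T) l
      (fun p => itIntAux (invX T b) p) (fun p => hc.cont p)
    simp only [convL]
    have e : ∀ p, itIntAux (invX T b) (i :: p) x =
      ∫ u in (0:ℝ)..x, invX T b i u * itIntAux (invX T b) p u := fun p => by simp [itIntAux]
    simp only [e]
    rw [← key]
    simp only [← ih]
    have e2 : ∫ u in (0:ℝ)..x, invX T b i u * itIntAux b l (T - u)
        = - ∫ u in (T - x)..T, b i u * itIntAux b l u := by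
      have := intervalIntegral.integral_comp_sub_left (a := 0) (b := x)
        (fun u => b i u * itIntAux b l u) T
      simp only [sub_zero] at this
      rw [← this, ← intervalIntegral.integral_neg]
      simp [invX]
    rw [e2]
    simp only [itIntAux]
    rw [← intervalIntegral.integral_add_adjacent_intervals
      (hb.ii i (hb.cont l) 0 (T - x)) (hb.ii i (hb.cont l) (T - x) T)]
    ring

lemma itInv_one {b : ℕ → ℝ → ℂ} (hb : Good b) (T : ℝ) (l : List ℕ) :
    convL (fun p => itIntAux (invX T b) p T) (fun q => itIntAux b q T) l =
      if l = [] then 1 else 0 := by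
  rw [← inv_formula hb T l T]
  cases l <;> simp [itIntAux]

lemma invX_invX (T : ℝ) (b : ℕ → ℝ → ℂ) : invX T (invX T b) = b := by
  ext i x; simp [invX]

lemma itInv_one' {b : ℕ → ℝ → ℂ} (hb : Good b) (T : ℝ) (l : List ℕ) :
    convL (fun p => itIntAux b p T) (fun q => itIntAux (invX T b) q T) l =
      if l = [] then 1 else 0 := by
  have := itInv_one (hb.invX T) T l
  rwa [invX_invX] at this

lemma star_first (T : ℝ) (a c : ℕ → ℝ → ℂ) (l : List ℕ) :
    ∀ y, 0 ≤ y → y ≤ T → itIntAux (starProd T a c) l (y / 2) = itIntAux c l y := by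
  induction l with
  | nil => intro y _ _; simp [itIntAux]
  | cons i l ih =>
    intro y h0 hy
    simp only [itIntAux]
    have := intervalIntegral.integral_comp_div (a := 0) (b := y)
        (fun u => starProd T a c i u * itIntAux (starProd T a c) l u) (two_ne_zero (α := ℝ))
    have h2 : ∫ u in (0:ℝ)..y, c i u * itIntAux c l u = ∫ u in (0:ℝ)..y,
        (1/2 : ℝ) • (starProd T a c i (u/2) * itIntAux (starProd T a c) l (u/2)) := by
      apply intervalIntegral.integral_congr
      intro u hu
      rw [Set.uIcc_of_le h0] at hu
      have hu' : u / 2 ≤ T / 2 := by linarith [hu.2]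
      simp only [ih u hu.1 (hu.2.trans hy)]
      simp only [starProd, if_pos hu']
      rw [mul_div_cancel₀ u two_ne_zero]
      simp; ring
    rw [h2, intervalIntegral.integral_smul, this]
    simp

lemma star_second {a c : ℕ → ℝ → ℂ} (ha : Good a) (hc : Good c) {T : ℝ} (hT : 0 < T)
    (l : List ℕ) : ∀ y, 0 ≤ y → y ≤ T → itIntAux (starProd T a c) l (y / 2 + T / 2) =
      convL (fun p => itIntAux a p y) (fun q => itIntAux c q T) l := by
  induction l with
  | nil => intro y _ _; simp [itIntAux, convL]
  | cons i l ih =>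
    intro y h0 hy
    have hs := ha.star hc T
    have key := convL_int ha i y (fun q => itIntAux c q T) l
      (fun p => itIntAux a p) (fun p => ha.cont p)
    have hf := star_first T a c (i :: l) T hT.le le_rfl
    simp only [convL]
    have e : ∀ p, itIntAux a (i :: p) y =
      ∫ u in (0:ℝ)..y, a i u * itIntAux a p u := fun p => by simp [itIntAux]
    simp only [e]
    rw [← key, ← hf]
    have this := intervalIntegral.integral_comp_div_add (a := 0) (b := y)
        (fun u => starProd T a c i u * itIntAux (starProd T a c) l u)
        (two_ne_zero (α := ℝ)) (T / 2)
    have h2 : ∫ u in (0:ℝ)..y, a i u * convL (fun p => itIntAux a p u)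
          (fun q => itIntAux c q T) l = ∫ u in (0:ℝ)..y, (1/2 : ℝ) •
          (starProd T a c i (u/2 + T/2) * itIntAux (starProd T a c) l (u/2 + T/2)) := by
      apply intervalIntegral.integral_congr_ae
      refine Filter.Eventually.of_forall fun u hu => ?_
      rw [Set.uIoc_of_le h0] at hu
      have hu' : ¬ (u / 2 + T / 2 ≤ T / 2) := by linarith [hu.1]
      simp only [ih u hu.1.le (hu.2.trans hy)]
      simp only [starProd, if_neg hu']
      rw [show 2 * (u / 2 + T / 2) - T = u by ring]
      simp; ring
    rw [h2, intervalIntegral.integral_smul, this]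
    simp only [itIntAux]
    rw [← intervalIntegral.integral_add_adjacent_intervals
      (hs.ii i (hs.cont l) 0 (T / 2)) (hs.ii i (hs.cont l) (T / 2) (y / 2 + T / 2))]
    simp

lemma chen {a c : ℕ → ℝ → ℂ} (ha : Good a) (hc : Good c) {T : ℝ} (hT : 0 < T)
    (l : List ℕ) : itIntAux (starProd T a c) l T =
      convL (fun p => itIntAux a p T) (fun q => itIntAux c q T) l := by
  rw [← star_second ha hc hT l T hT.le le_rfl, add_halves]

lemma itIntAux_congr {a a' : ℕ → ℝ → ℂ} {T : ℝ}
    (h : ∀ i, 1 ≤ i → ∀ x ∈ Set.Icc (0:ℝ) T, a i x = a' i x) (l : List ℕ)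
    (hl : ∀ i ∈ l, 1 ≤ i) : ∀ y ∈ Set.Icc (0:ℝ) T, itIntAux a l y = itIntAux a' l y := by
  induction l with
  | nil => intro y _; simp [itIntAux]
  | cons i l ih =>
    intro y hy
    simp only [itIntAux]
    apply intervalIntegral.integral_congr
    intro u hu
    rw [Set.uIcc_of_le hy.1] at hu
    have hu' : u ∈ Set.Icc (0:ℝ) T := ⟨hu.1, hu.2.trans hy.2⟩
    simp only
    rw [h i (hl i (by simp)) u hu', ih (fun j hj => hl j (by simp [hj])) u hu']

def trunc (T : ℝ) (a : ℕ → ℝ → ℂ) : ℕ → ℝ → ℂ := fun i =>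
  if 1 ≤ i then (Set.Icc (0:ℝ) T).indicator (a i) else 0

lemma trunc_eq (T : ℝ) (a : ℕ → ℝ → ℂ) :
    ∀ i, 1 ≤ i → ∀ x ∈ Set.Icc (0:ℝ) T, a i x = trunc T a i x := by
  intro i hi x hx
  simp only [trunc, if_pos hi]
  rw [Set.indicator_of_mem hx]

lemma trunc_good {T : ℝ} {a : ℕ → ℝ → ℂ} (ha : MemX T a) : Good (trunc T a) := by
  obtain ⟨hm, C, hC⟩ := ha
  intro i
  by_cases hi : 1 ≤ i
  · simp only [trunc, if_pos hi]
    refine ⟨(hm i).indicator measurableSet_Icc, max (C ^ i) 0, fun x => ?_⟩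
    by_cases hx : x ∈ Set.Icc (0:ℝ) T
    · rw [Set.indicator_of_mem hx]; exact le_max_of_le_left (hC i hi x hx)
    · rw [Set.indicator_of_notMem hx]; simp
  · simp only [trunc, if_neg hi]
    exact ⟨measurable_zero, 0, fun x => by simp⟩

lemma star_trunc (T : ℝ) (a b : ℕ → ℝ → ℂ) :
    ∀ i, 1 ≤ i → ∀ x ∈ Set.Icc (0:ℝ) T, starProd T a (invX T b) i x =
      starProd T (trunc T a) (invX T (trunc T b)) i x := by
  intro i hi x hx
  simp only [starProd, invX]
  split_ifs with h
  · rw [trunc_eq T b i hi (T - 2 * x) ⟨by linarith, by linarith [hx.1]⟩]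
  · rw [trunc_eq T a i hi (2 * x - T) ⟨by linarith, by linarith [hx.2]⟩]

lemma core {T : ℝ} (hT : 0 < T) {a b : ℕ → ℝ → ℂ} (ha : Good a) (hb : Good b) :
    (∀ l : List ℕ, l ≠ [] → (∀ i ∈ l, 1 ≤ i) →
        itIntAux (starProd T a (invX T b)) l T = 0) ↔
      (∀ l : List ℕ, (∀ i ∈ l, 1 ≤ i) → itIntAux a l T = itIntAux b l T) := by
  simp only [chen ha (hb.invX T) hT]
  constructor
  · intro H l hl
    rw [← sub_eq_zero]
    refine convL_zero (fun q => itIntAux (invX T b) q T) (by simp [itIntAux]) l hl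
      (fun p => itIntAux a p T - itIntAux b p T) ?_
    intro p hp
    rw [convL_sub, itInv_one' hb]
    by_cases h : p = []
    · subst h; simp [convL, itIntAux]
    · rw [H p h hp]; simp [h]
  · intro H l hne hl
    rw [convL_congr _ l hl _ (fun p => itIntAux b p T) H, itInv_one' hb, if_neg hne]

/-- all basic iterated integrals of positive order vanish at `a * b⁻¹` iff
`I_{i₁,…,iₖ}(a) = I_{i₁,…,iₖ}(b)` for every multi-index of positive integers. -/
theorem iterated_integrals_vanish_iff_eq (T : ℝ) (hT : 0 < T) (a b : ℕ → ℝ → ℂ)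
    (ha : MemX T a) (hb : MemX T b) :
    (∀ l : List ℕ, l ≠ [] → (∀ i ∈ l, 1 ≤ i) →
        itInt T (starProd T a (invX T b)) l = 0) ↔
      (∀ l : List ℕ, (∀ i ∈ l, 1 ≤ i) → itInt T a l = itInt T b l) := by
  have hTm : T ∈ Set.Icc (0:ℝ) T := ⟨hT.le, le_rfl⟩
  have hc := core hT (trunc_good ha) (trunc_good hb)
  unfold itInt
  constructor
  · intro H l hl
    have hl' : ∀ i ∈ l.reverse, 1 ≤ i := fun i hi => hl i (by simpa using hi)
    rw [itIntAux_congr (trunc_eq T a) _ hl' T hTm, itIntAux_congr (trunc_eq T b) _ hl' T hTm]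
    refine hc.1 ?_ _ hl'
    intro p hne hp
    have := H p.reverse (by simpa using hne) (fun i hi => hp i (by simpa using hi))
    rw [List.reverse_reverse] at this
    rw [← itIntAux_congr (star_trunc T a b) _ hp T hTm, this]
  · intro H l hne hl
    have hl' : ∀ i ∈ l.reverse, 1 ≤ i := fun i hi => hl i (by simpa using hi)
    rw [itIntAux_congr (star_trunc T a b) _ hl' T hTm]
    refine hc.2 ?_ _ (by simpa using hne) hl'
    intro p hp
    have := H p.reverse (fun i hi => hp i (by simpa using hi))
    rw [List.reverse_reverse] at this
    rw [← itIntAux_congr (trunc_eq T a) _ hp T hTm, ← itIntAux_congr (trunc_eq T b) _ hp T hTm,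
      this]
end
end

section
/- (Ree shuffle formula for basic iterated integrals.) For every a ∈ X, all r,s ≥ 1 and all positive integers i_1,…,i_{r+s}: I_{i_1,…,i_r}(a) · I_{i_{r+1},…,i_{r+s}}(a) = ∑_σ I_{i_{σ(1)},…,i_{σ(r+s)}}(a), where the sum is taken over all shuffles σ of type (r,s). -/
open MeasureTheory

noncomputable section

/-- A permutation `σ` of `{1, …, r+s}` (here `Fin (r+s)`) is a shuffle of type `(r,s)` if
`σ⁻¹` is strictly increasing on the first `r` and on the last `s` indices. -/
def IsShuffle (r s : ℕ) (σ : Equiv.Perm (Fin (r + s))) : Prop :=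
  StrictMono (fun j : Fin r => σ.symm (Fin.castAdd s j)) ∧
    StrictMono (fun j : Fin s => σ.symm (Fin.natAdd r j))

theorem ibp_real {f g : ℝ → ℝ} {x : ℝ} (hf : IntervalIntegrable f volume 0 x)
    (hg : IntervalIntegrable g volume 0 x) :
    (∫ t in (0:ℝ)..x, f t) * (∫ t in (0:ℝ)..x, g t) =
      ∫ t in (0:ℝ)..x, (f t * (∫ u in (0:ℝ)..t, g u) + (∫ u in (0:ℝ)..t, f u) * g t) := by
  have hF := hf.absolutelyContinuousOnInterval_intervalIntegral (c := 0) Set.left_mem_uIcc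
  have hG := hg.absolutelyContinuousOnInterval_intervalIntegral (c := 0) Set.left_mem_uIcc
  have h := hF.integral_deriv_mul_eq_sub hG
  simp only [intervalIntegral.integral_same, mul_zero, sub_zero] at h
  rw [← h]
  apply intervalIntegral.integral_congr_ae
  filter_upwards [hf.ae_hasDerivAt_integral, hg.ae_hasDerivAt_integral] with t h1 h2 h3
  have h4 := Set.uIoc_subset_uIcc h3
  rw [(h1 h4 0 Set.left_mem_uIcc).deriv, (h2 h4 0 Set.left_mem_uIcc).deriv]

theorem ibp_complex {f g : ℝ → ℂ} {x : ℝ} (hf : IntervalIntegrable f volume 0 x)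
    (hg : IntervalIntegrable g volume 0 x) :
    (∫ t in (0:ℝ)..x, f t) * (∫ t in (0:ℝ)..x, g t) =
      ∫ t in (0:ℝ)..x, (f t * (∫ u in (0:ℝ)..t, g u) + (∫ u in (0:ℝ)..t, f u) * g t) := by
  have cont : ∀ {h : ℝ → ℂ}, IntervalIntegrable h volume 0 x →
      ContinuousOn (fun t => ∫ u in (0:ℝ)..t, h u) (Set.uIcc 0 x) := fun hh =>
    intervalIntegral.continuousOn_primitive_interval' hh Set.left_mem_uIcc
  have contr : ∀ {h : ℝ → ℝ}, IntervalIntegrable h volume 0 x →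
      ContinuousOn (fun t => ∫ u in (0:ℝ)..t, h u) (Set.uIcc 0 x) := fun hh =>
    intervalIntegral.continuousOn_primitive_interval' hh Set.left_mem_uIcc
  have reI : ∀ {h : ℝ → ℂ} {t : ℝ}, IntervalIntegrable h volume 0 t →
      (∫ u in (0:ℝ)..t, h u).re = ∫ u in (0:ℝ)..t, (h u).re := fun hh =>
    (Complex.reCLM.intervalIntegral_comp_comm hh).symm
  have imI : ∀ {h : ℝ → ℂ} {t : ℝ}, IntervalIntegrable h volume 0 t →
      (∫ u in (0:ℝ)..t, h u).im = ∫ u in (0:ℝ)..t, (h u).im := fun hh =>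
    (Complex.imCLM.intervalIntegral_comp_comm hh).symm
  have hre : ∀ {h : ℝ → ℂ}, IntervalIntegrable h volume 0 x →
      IntervalIntegrable (fun t => (h t).re) volume 0 x := fun hh => ⟨hh.1.re, hh.2.re⟩
  have him : ∀ {h : ℝ → ℂ}, IntervalIntegrable h volume 0 x →
      IntervalIntegrable (fun t => (h t).im) volume 0 x := fun hh => ⟨hh.1.im, hh.2.im⟩
  have hI : IntervalIntegrable (fun t => f t * (∫ u in (0:ℝ)..t, g u) +
      (∫ u in (0:ℝ)..t, f u) * g t) volume 0 x :=
    (hf.mul_continuousOn (cont hg)).add (hg.continuousOn_mul (cont hf))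
  have hIr : ∀ {p q : ℝ → ℝ}, IntervalIntegrable p volume 0 x →
      IntervalIntegrable q volume 0 x →
      IntervalIntegrable (fun t => p t * (∫ u in (0:ℝ)..t, q u) +
      (∫ u in (0:ℝ)..t, p u) * q t) volume 0 x := fun hp hq =>
    (hp.mul_continuousOn (contr hq)).add (hq.continuousOn_mul (contr hp))
  have sub : ∀ {h : ℝ → ℂ} {t : ℝ}, t ∈ Set.uIcc 0 x → IntervalIntegrable h volume 0 x →
      IntervalIntegrable h volume 0 t := fun ht hh =>
    hh.mono_set (Set.uIcc_subset_uIcc Set.left_mem_uIcc ht)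
  apply Complex.ext
  · rw [Complex.mul_re, reI hI, reI hf, reI hg, imI hf, imI hg, ibp_real (hre hf) (hre hg),
      ibp_real (him hf) (him hg), ← intervalIntegral.integral_sub (hIr (hre hf) (hre hg))
      (hIr (him hf) (him hg))]
    apply intervalIntegral.integral_congr
    intro t ht
    simp only [Complex.add_re, Complex.mul_re, reI (sub ht hf), reI (sub ht hg),
      imI (sub ht hf), imI (sub ht hg)]
    ring
  · rw [Complex.mul_im, imI hI, reI hf, reI hg, imI hf, imI hg, ibp_real (hre hf) (him hg),
      ibp_real (him hf) (hre hg), ← intervalIntegral.integral_add (hIr (hre hf) (him hg))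
      (hIr (him hf) (hre hg))]
    apply intervalIntegral.integral_congr
    intro t ht
    simp only [Complex.add_im, Complex.mul_im, reI (sub ht hf), reI (sub ht hg),
      imI (sub ht hf), imI (sub ht hg)]
    ring

theorem aux_int {T : ℝ} (hT : 0 < T) {a : ℕ → ℝ → ℂ} (ha : MemX T a) {i : ℕ} (hi : 1 ≤ i) :
    IntervalIntegrable (a i) volume 0 T := by
  obtain ⟨hm, C, hC⟩ := ha
  rw [intervalIntegrable_iff_integrableOn_Icc_of_le hT.le]
  refine Measure.integrableOn_of_bounded (M := C ^ i) (by simp)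
    (hm i).aestronglyMeasurable ?_
  exact (ae_restrict_iff' measurableSet_Icc).2 (Filter.Eventually.of_forall (hC i hi))

theorem aux_cont {T : ℝ} (hT : 0 < T) {a : ℕ → ℝ → ℂ} (ha : MemX T a) (l : List ℕ)
    (hl : ∀ i ∈ l, 1 ≤ i) : ContinuousOn (itIntAux a l) (Set.uIcc 0 T) := by
  induction l with
  | nil => exact continuousOn_const
  | cons i l ih =>
    have h1 : IntervalIntegrable (fun s => a i s * itIntAux a l s) volume 0 T :=
      (aux_int hT ha (hl i (by simp))).mul_continuousOn
        (ih fun j hj => hl j (by simp [hj]))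
    exact intervalIntegral.continuousOn_primitive_interval' h1 Set.left_mem_uIcc

theorem aux_int2 {T : ℝ} (hT : 0 < T) {a : ℕ → ℝ → ℂ} (ha : MemX T a) (i : ℕ) (l : List ℕ)
    (hi : 1 ≤ i) (hl : ∀ i ∈ l, 1 ≤ i) :
    IntervalIntegrable (fun s => a i s * itIntAux a l s) volume 0 T :=
  (aux_int hT ha hi).mul_continuousOn (aux_cont hT ha l hl)

/-- list of shuffles -/
def shuf {α : Type*} : List α → List α → List (List α)
  | [], v => [v]
  | x :: u, [] => [x :: u]
  | x :: u, y :: v => (shuf u (y :: v)).map (x :: ·) ++ (shuf (x :: u) v).map (y :: ·)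
termination_by u v => u.length + v.length

theorem shuf_perm {α : Type*} (u v : List α) : ∀ w ∈ shuf u v,
    w.Perm (u ++ v) ∧ u.Sublist w ∧ v.Sublist w := by
  fun_induction shuf u v with
  | case1 v => simp
  | case2 x u => simp
  | case3 x u y v ih1 ih2 =>
    intro w hw
    simp only [List.mem_append, List.mem_map] at hw
    rcases hw with ⟨w, hw, rfl⟩ | ⟨w, hw, rfl⟩
    · obtain ⟨h1, h2, h3⟩ := ih1 w hw
      exact ⟨h1.cons x, h2.cons_cons x, h3.cons x⟩
    · obtain ⟨h1, h2, h3⟩ := ih2 w hw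
      exact ⟨(h1.cons y).trans List.perm_middle.symm, h2.cons y, h3.cons_cons y⟩

theorem shuf_nodup {α : Type*} (u v : List α) (h : (u ++ v).Nodup) : (shuf u v).Nodup := by
  fun_induction shuf u v with
  | case1 v => simp
  | case2 x u => simp
  | case3 x u y v ih1 ih2 =>
    have hxy : x ≠ y := by rintro rfl; simp at h
    refine List.Nodup.append ((ih1 ?_).map List.cons_injective)
      ((ih2 ?_).map List.cons_injective) ?_
    · exact (List.nodup_cons.1 h).2
    · exact h.sublist (by simp)
    · intro w h1 h2
      simp only [List.mem_map] at h1 h2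
      obtain ⟨w1, _, rfl⟩ := h1
      obtain ⟨w2, _, h2⟩ := h2
      exact hxy (List.cons.inj h2).1.symm

theorem mem_shuf {α : Type*} (u v : List α) (h : (u ++ v).Nodup) (w : List α)
    (hp : w.Perm (u ++ v)) (hu : u.Sublist w) (hv : v.Sublist w) : w ∈ shuf u v := by
  fun_induction shuf u v generalizing w with
  | case1 v =>
    simp only [List.mem_singleton]
    exact (hv.eq_of_length hp.length_eq.symm).symm
  | case2 x u =>
    simp only [List.mem_singleton]
    exact (hu.eq_of_length (by simpa using hp.length_eq.symm)).symm
  | case3 x u y v ih1 ih2 =>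
    have hxy : x ≠ y := by rintro rfl; simp at h
    have hw := hp.nodup_iff.2 h
    cases w with
    | nil => simp at hu
    | cons z w =>
      have hzw := (List.nodup_cons.1 hw).1
      have hz : z ∈ (x :: u) ++ (y :: v) := hp.subset (by simp)
      have hd := (List.nodup_append'.1 h).2.2
      simp only [List.mem_append, List.mem_map]
      rcases List.mem_append.1 hz with hz | hz
      · left
        rcases List.sublist_cons_iff.1 hu with h' | ⟨r, hr, hu'⟩
        · exact absurd (h'.subset hz) hzw
        · obtain ⟨rfl, rfl⟩ := List.cons.inj hr
          refine ⟨w, ih1 (List.nodup_cons.1 h).2 w (by simpa using hp) hu' ?_, rfl⟩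
          rcases List.sublist_cons_iff.1 hv with h' | ⟨r, hr, hu'⟩
          · exact h'
          · exact absurd (List.cons.inj hr).1.symm hxy
      · right
        rcases List.sublist_cons_iff.1 hv with h' | ⟨r, hr, hv'⟩
        · exact absurd (h'.subset hz) hzw
        · obtain ⟨rfl, rfl⟩ := List.cons.inj hr
          refine ⟨w, ih2 (h.sublist (by simp)) w ?_ ?_ hv', rfl⟩
          · exact (List.perm_cons y).1 (hp.trans List.perm_middle)
          rcases List.sublist_cons_iff.1 hu with h' | ⟨r, hr, hu'⟩
          · exact h'
          · exact absurd (List.cons.inj hr).1 hxy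

theorem shuf_map {α β : Type*} (f : α → β) (u v : List α) :
    shuf (u.map f) (v.map f) = (shuf u v).map (List.map f) := by
  fun_induction shuf u v with
  | case1 v => simp [shuf]
  | case2 x u => simp [shuf]
  | case3 x u y v ih1 ih2 =>
    simp only [List.map_cons] at ih1 ih2
    simp [shuf, ih1, ih2, Function.comp_def]

theorem sum_aux {T : ℝ} (hT : 0 < T) {a : ℕ → ℝ → ℂ} (ha : MemX T a) (i : ℕ) (hi : 1 ≤ i)
    {x : ℝ} (hx : x ∈ Set.uIcc 0 T)
    (L : List (List ℕ)) (hL : ∀ l ∈ L, ∀ j ∈ l, 1 ≤ j) :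
    IntervalIntegrable (fun t => a i t * (L.map fun w => itIntAux a w t).sum) volume 0 x ∧
    ((L.map (i :: ·)).map fun w => itIntAux a w x).sum =
      ∫ t in (0:ℝ)..x, a i t * (L.map fun w => itIntAux a w t).sum := by
  induction L with
  | nil => simp
  | cons l L ih =>
    obtain ⟨h1, h2⟩ := ih fun l hl => hL l (by simp [hl])
    have h3 : IntervalIntegrable (fun s => a i s * itIntAux a l s) volume 0 x :=
      (aux_int2 hT ha i l hi (hL l (by simp))).mono_set
      (Set.uIcc_subset_uIcc Set.left_mem_uIcc hx)
    simp only [List.map_cons, List.sum_cons, mul_add]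
    refine ⟨h3.add h1, ?_⟩
    rw [intervalIntegral.integral_add h3 h1, h2]
    rfl

theorem aux_shuf {T : ℝ} (hT : 0 < T) {a : ℕ → ℝ → ℂ} (ha : MemX T a) (u v : List ℕ)
    (hu : ∀ i ∈ u, 1 ≤ i) (hv : ∀ i ∈ v, 1 ≤ i) (x : ℝ) (hx : x ∈ Set.uIcc 0 T) :
    itIntAux a u x * itIntAux a v x = ((shuf u v).map fun w => itIntAux a w x).sum := by
  fun_induction shuf u v generalizing x with
  | case1 v => simp [itIntAux]
  | case2 i u => simp [itIntAux]
  | case3 i u j v ih1 ih2 =>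
    have hu' : ∀ k ∈ u, 1 ≤ k := fun k hk => hu k (by simp [hk])
    have hv' : ∀ k ∈ v, 1 ≤ k := fun k hk => hv k (by simp [hk])
    have hi := hu i (by simp)
    have hj := hv j (by simp)
    have key : ∀ u v : List ℕ, (∀ i ∈ u, 1 ≤ i) → (∀ i ∈ v, 1 ≤ i) →
        ∀ l ∈ shuf u v, ∀ k ∈ l, 1 ≤ k := by
      intro u v hu hv l hl k hk
      rcases List.mem_append.1 ((shuf_perm u v l hl).1.subset hk) with h | h
      · exact hu k h
      · exact hv k h
    obtain ⟨p1, p2⟩ := sum_aux hT ha i hi hx _ (key u (j :: v) hu' hv)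
    obtain ⟨q1, q2⟩ := sum_aux hT ha j hj hx _ (key (i :: u) v hu hv')
    have hs := Set.uIcc_subset_uIcc (Set.left_mem_uIcc (a := (0:ℝ)) (b := T)) hx
    rw [List.map_append, List.sum_append, p2, q2, ← intervalIntegral.integral_add p1 q1]
    refine (ibp_complex ((aux_int2 hT ha i u hi hu').mono_set hs)
      ((aux_int2 hT ha j v hj hv').mono_set hs)).trans ?_
    apply intervalIntegral.integral_congr
    intro t ht
    simp only
    rw [← ih1 hu' hv t (hs ht), ← ih2 hu hv' t (hs ht)]
    simp only [itIntAux]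
    ring

theorem sublist_ofFn {n m : ℕ} (f : Fin m → Fin n) (σ : Equiv.Perm (Fin n)) :
    (List.ofFn f).Sublist (List.ofFn σ) ↔ StrictMono fun j => σ.symm (f j) := by
  rw [List.sublist_iff_exists_fin_orderEmbedding_get_eq]
  constructor
  · rintro ⟨g, hg⟩ j k hjk
    have e : ∀ j : Fin m, σ.symm (f j) = Fin.cast (by simp) (g (Fin.cast (by simp) j)) := by
      intro j
      have := hg (Fin.cast (by simp) j)
      rw [Equiv.symm_apply_eq]
      simp only [List.get_ofFn] at this
      exact this
    simp only [e]
    have := g.strictMono (a := Fin.cast (by simp) j) (b := Fin.cast (by simp) k) (by simpa using hjk)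
    simpa using this
  · intro h
    refine ⟨OrderEmbedding.ofStrictMono (fun j => Fin.cast (by simp)
      (σ.symm (f (Fin.cast (by simp) j)))) ?_, ?_⟩
    · intro j k hjk
      have := h (a := Fin.cast (by simp) j) (b := Fin.cast (by simp) k) (by simpa using hjk)
      simpa using this
    · intro j
      simp only [List.get_ofFn]
      exact (σ.apply_symm_apply _).symm

open scoped Classical in
/-- Ree shuffle formula:
`I_{i₁,…,i_r}(a) · I_{i_{r+1},…,i_{r+s}}(a) = ∑_σ I_{i_{σ(1)},…,i_{σ(r+s)}}(a)`,
the sum over all shuffles `σ` of type `(r,s)`. -/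
theorem ree_shuffle_formula (T : ℝ) (hT : 0 < T) (a : ℕ → ℝ → ℂ) (ha : MemX T a)
    (r s : ℕ) (hr : 1 ≤ r) (hs : 1 ≤ s) (i : Fin (r + s) → ℕ) (hi : ∀ j, 1 ≤ i j) :
    itInt T a (List.ofFn fun j : Fin r => i (Fin.castAdd s j)) *
        itInt T a (List.ofFn fun j : Fin s => i (Fin.natAdd r j)) =
      ∑ σ ∈ Finset.univ.filter (IsShuffle r s),
        itInt T a (List.ofFn fun j : Fin (r + s) => i (σ j)) := by

  set U : List (Fin (r + s)) := List.ofFn fun j : Fin r => Fin.castAdd s j with hU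
  set V : List (Fin (r + s)) := List.ofFn fun j : Fin s => Fin.natAdd r j with hV
  have hUV : U ++ V = List.ofFn (id : Fin (r + s) → Fin (r + s)) := by
    rw [hU, hV, ← List.ofFn_fin_append]
    congr 1
    funext j
    refine Fin.addCases (fun j => ?_) (fun j => ?_) j <;> simp
  have hnd : (U ++ V).Nodup := by
    rw [hUV]; exact List.nodup_ofFn.2 Function.injective_id
  have hnd' : (U.reverse ++ V.reverse).Nodup := by
    rw [← List.reverse_append, List.nodup_reverse]
    exact (List.perm_append_comm.nodup_iff).1 hnd
  have e1 : (List.ofFn fun j : Fin r => i (Fin.castAdd s j)) = U.map i := by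
    simp [hU, List.map_ofFn, Function.comp_def]
  have e2 : (List.ofFn fun j : Fin s => i (Fin.natAdd r j)) = V.map i := by
    simp [hV, List.map_ofFn, Function.comp_def]
  have e3 : ∀ σ : Equiv.Perm (Fin (r + s)), (List.ofFn fun j => i (σ j)) =
      (List.ofFn σ).map i := by
    intro σ; simp [List.map_ofFn, Function.comp_def]
  simp only [itInt, e1, e2, e3, ← List.map_reverse]
  rw [aux_shuf hT ha _ _ (by simp [hi]) (by simp [hi]) T Set.right_mem_uIcc, shuf_map,
    List.map_map, ← List.sum_toFinset _ (shuf_nodup _ _ hnd')]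
  symm
  refine Finset.sum_bij (fun σ _ => (List.ofFn σ).reverse) ?_ ?_ ?_ ?_
  · intro σ hσ
    simp only [Finset.mem_filter, Finset.mem_univ, true_and] at hσ
    rw [List.mem_toFinset]
    refine mem_shuf _ _ hnd' _ ?_ ?_ ?_
    · rw [← List.reverse_append]
      refine (List.reverse_perm _).trans (List.Perm.trans ?_ (List.reverse_perm _).symm)
      refine List.Perm.trans ?_ List.perm_append_comm
      rw [hUV, List.perm_ext_iff_of_nodup (List.nodup_ofFn.2 σ.injective)
        (List.nodup_ofFn.2 Function.injective_id)]
      intro j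
      rw [List.mem_ofFn, List.mem_ofFn]
      exact ⟨fun _ => ⟨j, rfl⟩, fun _ => σ.surjective j⟩
    · exact ((sublist_ofFn _ σ).2 hσ.1).reverse
    · exact ((sublist_ofFn _ σ).2 hσ.2).reverse
  · intro σ _ τ _ h
    exact Equiv.coe_fn_injective (List.ofFn_injective (List.reverse_injective h))
  · intro w hw
    rw [List.mem_toFinset] at hw
    obtain ⟨h1, h2, h3⟩ := shuf_perm _ _ _ hw
    have hwn : w.Nodup := h1.nodup_iff.2 hnd'
    have hlen : w.reverse.length = r + s := by
      have := h1.length_eq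
      simpa [hU, hV] using this
    have hf : Function.Injective (fun j : Fin (r + s) => w.reverse.get (Fin.cast hlen.symm j)) := by
      intro j k hjk
      have := (List.nodup_iff_injective_get.1 (List.nodup_reverse.2 hwn)) hjk
      simpa using this
    let σ : Equiv.Perm (Fin (r + s)) := Equiv.ofBijective _ (Finite.injective_iff_bijective.1 hf)
    have hσ : List.ofFn σ = w.reverse := by
      apply List.ext_get
      · simp [hlen]
      · intro n h1 h2
        simp [σ]
    refine ⟨σ, ?_, by simp [hσ]⟩
    simp only [Finset.mem_filter, Finset.mem_univ, true_and]
    refine ⟨(sublist_ofFn _ σ).1 ?_, (sublist_ofFn _ σ).1 ?_⟩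
    · rw [hσ]; simpa using h2.reverse
    · rw [hσ]; simpa using h3.reverse
  · intro σ _
    simp
end
end

section
/- For every a ∈ X there exists ε>0 such that for each r ∈ ℂ with |r|<ε there is a unique Lipschitz function v: I_T → ℂ with v(0)=r such that for almost every x ∈ I_T the series ∑_{i=1}^∞ a_i(x) v(x)^{i+1} converges absolutely and v′(x) = ∑_{i=1}^∞ a_i(x) v(x)^{i+1}. -/
open MeasureTheory

noncomputable section

/-- `v` is a Lipschitz solution on `[0,T]` of `v' = ∑_{i≥1} aᵢ(x) v^{i+1}`:
`v` is Lipschitz on `[0,T]` and for a.e. `x ∈ [0,T]` the series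
`∑_{i≥1} aᵢ(x) v(x)^{i+1}` converges absolutely and is the derivative of `v` at `x`. -/
def IsODESol (T : ℝ) (a : ℕ → ℝ → ℂ) (v : ℝ → ℂ) : Prop :=
  (∃ K : NNReal, LipschitzOnWith K v (Set.Icc 0 T)) ∧
    ∀ᵐ x ∂(volume.restrict (Set.Icc (0 : ℝ) T)),
      (Summable fun i : ℕ => ‖a (i + 1) x * v x ^ (i + 2)‖) ∧
        HasDerivAt v (∑' i : ℕ, a (i + 1) x * v x ^ (i + 2)) x

lemma aux_mvt (f : ℝ → ℂ) (t B : ℝ) (ht : 0 ≤ t) (K : NNReal)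
    (hf : LipschitzOnWith K f (Set.Icc 0 t)) (g : ℝ → ℂ)
    (hg : ∀ᵐ x, x ∈ Set.Ioo 0 t → HasDerivAt f (g x) x ∧ ‖g x‖ ≤ B) :
    ‖f t - f 0‖ ≤ B * t := by
  set z := f t - f 0 with hz
  let φ : ℝ → ℝ := fun x => inner ℝ z (f x)
  have hφ : LipschitzOnWith (‖z‖₊ * K) φ (Set.Icc 0 t) := by
    refine LipschitzOnWith.of_dist_le_mul ?_
    intro x hx y hy
    have h1 := hf.dist_le_mul x hx y hy
    rw [Real.dist_eq]
    have : φ x - φ y = inner ℝ z (f x - f y) := by simp only [φ, inner_sub_right]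
    rw [this]
    refine (abs_real_inner_le_norm _ _).trans ?_
    rw [← dist_eq_norm (f x) (f y)]
    push_cast
    rw [mul_assoc]
    exact mul_le_mul_of_nonneg_left h1 (norm_nonneg z)
  have hac : AbsolutelyContinuousOnInterval φ 0 t := by
    apply LipschitzOnWith.absolutelyContinuousOnInterval (K := ‖z‖₊ * K)
    rwa [Set.uIcc_of_le ht]
  have h1 := hac.integral_deriv_eq_sub
  have h2 : φ t - φ 0 = ‖z‖ * ‖z‖ := by
    simp only [φ]
    rw [← inner_sub_right, ← hz, real_inner_self_eq_norm_mul_norm]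
  have hne : ∀ᵐ x : ℝ, x ≠ t := by simp [ae_iff, measure_singleton]
  have h3 : ‖∫ x in (0:ℝ)..t, deriv φ x‖ ≤ (‖z‖ * B) * |t - 0| := by
    apply intervalIntegral.norm_integral_le_of_norm_le_const_ae
    filter_upwards [hg, hne] with x hx hxt hxi
    rw [Set.uIoc_of_le ht] at hxi
    obtain ⟨hd, hb⟩ := hx ⟨hxi.1, lt_of_le_of_ne hxi.2 hxt⟩
    have : HasDerivAt φ (inner ℝ z (g x)) x := by
      have := (innerSL ℝ z).hasFDerivAt.comp_hasDerivAt x hd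
      exact this
    rw [this.deriv]
    exact (norm_inner_le_norm _ _).trans (mul_le_mul_of_nonneg_left hb (norm_nonneg _))
  rw [h1, h2, sub_zero, abs_of_nonneg ht, Real.norm_of_nonneg (by positivity)] at h3
  by_cases h0 : ‖z‖ = 0
  · rw [h0]
    by_cases ht0 : t = 0
    · simp [ht0]
    have htp : 0 < t := lt_of_le_of_ne ht (Ne.symm ht0)
    have : ∃ x ∈ Set.Ioo 0 t, ‖g x‖ ≤ B := by
      by_contra hcon
      push Not at hcon
      have hh : ∀ᵐ x : ℝ, x ∉ Set.Ioo 0 t := by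
        filter_upwards [hg] with x hx hxi
        exact absurd (hx hxi).2 (not_le.mpr (hcon x hxi))
      rw [ae_iff] at hh
      simp only [not_not] at hh
      have h5 : volume (Set.Ioo 0 t) = 0 := hh
      rw [Real.volume_Ioo] at h5
      simp at h5
      linarith
    obtain ⟨x, -, hx⟩ := this
    have := (norm_nonneg _).trans hx
    positivity
  · have hp : 0 < ‖z‖ := lt_of_le_of_ne (norm_nonneg _) (Ne.symm h0)
    rw [mul_assoc] at h3
    exact le_of_mul_le_mul_left h3 hp

lemma aux_pow (z w : ℂ) (ρ : ℝ) (hz : ‖z‖ ≤ ρ) (hw : ‖w‖ ≤ ρ) (n : ℕ) :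
    ‖z ^ (n + 1) - w ^ (n + 1)‖ ≤ (n + 1) * ρ ^ n * ‖z - w‖ := by
  have hρ : 0 ≤ ρ := (norm_nonneg _).trans hz
  induction n with
  | zero => simp
  | succ n ih =>
    have : z ^ (n + 1 + 1) - w ^ (n + 1 + 1)
        = z ^ (n + 1) * (z - w) + (z ^ (n + 1) - w ^ (n + 1)) * w := by ring
    rw [this]
    refine (norm_add_le _ _).trans ?_
    rw [norm_mul, norm_mul, norm_pow]
    have h1 : ‖z‖ ^ (n + 1) * ‖z - w‖ ≤ ρ ^ (n + 1) * ‖z - w‖ := by gcongr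
    have h2 : ‖z ^ (n + 1) - w ^ (n + 1)‖ * ‖w‖ ≤ ((n + 1) * ρ ^ n * ‖z - w‖) * ρ := by gcongr
    refine (add_le_add h1 h2).trans (le_of_eq ?_)
    push_cast
    ring

def auxF (T : ℝ) (a : ℕ → ℝ → ℂ) (x : ℝ) (z : ℂ) : ℂ :=
  ∑' i : ℕ, (Set.Icc (0 : ℝ) T).indicator (a (i + 1)) x * z ^ (i + 2)

lemma auxF_of_mem (T : ℝ) (a : ℕ → ℝ → ℂ) (x : ℝ) (z : ℂ) (hx : x ∈ Set.Icc 0 T) :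
    auxF T a x z = ∑' i : ℕ, a (i + 1) x * z ^ (i + 2) := by
  simp [auxF, Set.indicator_of_mem hx]

lemma auxF_of_notMem (T : ℝ) (a : ℕ → ℝ → ℂ) (x : ℝ) (z : ℂ) (hx : x ∉ Set.Icc 0 T) :
    auxF T a x z = 0 := by
  simp [auxF, Set.indicator_of_notMem hx]

lemma auxF_zero (T : ℝ) (a : ℕ → ℝ → ℂ) (x : ℝ) : auxF T a x 0 = 0 := by
  simp [auxF]

lemma auxF_props (T : ℝ) (hT : 0 < T) (a : ℕ → ℝ → ℂ) (ha : MemX T a) :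
    ∃ δ > (0:ℝ), ∃ L : ℝ, 0 ≤ L ∧ L * T ≤ 1 / 2 ∧
      (∀ x z, ‖z‖ ≤ δ →
        Summable fun i : ℕ => ‖(Set.Icc (0 : ℝ) T).indicator (a (i + 1)) x * z ^ (i + 2)‖) ∧
      (∀ x z w, ‖z‖ ≤ δ → ‖w‖ ≤ δ → ‖auxF T a x z - auxF T a x w‖ ≤ L * ‖z - w‖) := by
  obtain ⟨hm, C, hC⟩ := ha
  set M : ℝ := |C| + 1 with hM
  have hMp : 0 < M := by positivity
  have hb : ∀ (i : ℕ) x, ‖(Set.Icc (0 : ℝ) T).indicator (a (i + 1)) x‖ ≤ M ^ (i + 1) := by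
    intro i x
    by_cases hx : x ∈ Set.Icc (0:ℝ) T
    · rw [Set.indicator_of_mem hx]
      refine (hC (i + 1) (by omega) x hx).trans ?_
      refine (le_abs_self _).trans ?_
      rw [abs_pow]
      exact pow_le_pow_left₀ (abs_nonneg _) (by linarith) _
    · rw [Set.indicator_of_notMem hx]
      simp only [norm_zero]
      positivity
  have hs : Summable fun i : ℕ => ((i : ℝ) + 2) * (1 / 2 : ℝ) ^ i := by
    have h1 := summable_pow_mul_geometric_of_norm_lt_one (R := ℝ) 1 (r := 1 / 2) (by norm_num)
    have h0 := summable_geometric_of_lt_one (r := (1 / 2 : ℝ)) (by norm_num) (by norm_num)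
    refine (h1.add (h0.mul_left 2)).congr ?_
    intro i
    ring
  set S := ∑' i : ℕ, ((i : ℝ) + 2) * (1 / 2 : ℝ) ^ i with hS
  have hS0 : 0 ≤ S := tsum_nonneg fun i => by positivity
  set q : ℝ := min (1 / 2) (1 / (2 * (S + 1) * T)) with hq
  have hqp : 0 < q := by positivity
  have hq1 : q ≤ 1 / 2 := min_le_left _ _
  have hq2 : q ≤ 1 / (2 * (S + 1) * T) := min_le_right _ _
  have hqi : ∀ i : ℕ, M ^ (i + 1) * (q / M) ^ (i + 1) ≤ q * (1 / 2) ^ i := by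
    intro i
    rw [← mul_pow, mul_div_cancel₀ _ hMp.ne', pow_succ, mul_comm]
    gcongr
  have hsum : ∀ x z, ‖z‖ ≤ q / M →
        Summable fun i : ℕ => ‖(Set.Icc (0 : ℝ) T).indicator (a (i + 1)) x * z ^ (i + 2)‖ := by
    intro x z hz
    refine Summable.of_nonneg_of_le (fun _ => norm_nonneg _) ?_ (hs.mul_left (q * (q / M)))
    intro i
    rw [norm_mul, norm_pow]
    calc _ ≤ M ^ (i + 1) * (q / M) ^ (i + 2) := by gcongr; exact hb i x
      _ = (q / M) * (M ^ (i + 1) * (q / M) ^ (i + 1)) := by ring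
      _ ≤ (q / M) * (q * (1 / 2) ^ i) := by gcongr ?_ * ?_; exact hqi i
      _ = q * (q / M) * (1 * (1 / 2) ^ i) := by ring
      _ ≤ _ := by gcongr; linarith [(Nat.cast_nonneg i : (0:ℝ) ≤ i)]
  refine ⟨q / M, by positivity, q * S, by positivity, ?_, hsum, ?_⟩
  · rw [le_div_iff₀ (by positivity)] at hq2
    nlinarith [mul_pos hqp hT]
  · intro x z w hz hw
    unfold auxF
    rw [← Summable.tsum_sub (hsum x z hz).of_norm (hsum x w hw).of_norm]
    have hss := (hs.mul_left q).mul_right ‖z - w‖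
    refine (tsum_of_norm_bounded hss.hasSum ?_).trans (le_of_eq ?_)
    · intro i
      rw [← mul_sub, norm_mul]
      have h1 := aux_pow z w (q / M) hz hw (i + 1)
      calc _ ≤ M ^ (i + 1) * ((((i + 1 : ℕ) : ℝ) + 1) * (q / M) ^ (i + 1) * ‖z - w‖) := by
            gcongr
            exact hb i x
        _ = (M ^ (i + 1) * (q / M) ^ (i + 1)) * (i + 2) * ‖z - w‖ := by push_cast; ring
        _ ≤ (q * (1 / 2) ^ i) * (i + 2) * ‖z - w‖ := by gcongr ?_ * _ * _; exact hqi i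
        _ = _ := by ring
    · rw [tsum_mul_right, tsum_mul_left]

lemma auxF_meas (T : ℝ) (a : ℕ → ℝ → ℂ) (ha : MemX T a) (u : ℝ → ℂ) (hu : Continuous u)
    (hs : ∀ x, Summable fun i : ℕ =>
      ‖(Set.Icc (0 : ℝ) T).indicator (a (i + 1)) x * u x ^ (i + 2)‖) :
    Measurable fun x => auxF T a x (u x) := by
  refine measurable_of_tendsto_metrizable (f := fun n x => ∑ i ∈ Finset.range n,
    (Set.Icc (0 : ℝ) T).indicator (a (i + 1)) x * u x ^ (i + 2)) ?_ ?_
  · intro n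
    refine Finset.measurable_fun_sum _ fun i _ => ?_
    exact ((ha.1 _).indicator measurableSet_Icc).mul (hu.measurable.pow_const _)
  · rw [tendsto_pi_nhds]
    intro x
    exact (hs x).of_norm.hasSum.tendsto_sum_nat

lemma aux_int_s4 (T : ℝ) (hT : 0 < T) (g : ℝ → ℂ) (hg : Measurable g) (B : ℝ)
    (hB : ∀ x, ‖g x‖ ≤ B) (h0 : ∀ x, x ∉ Set.Icc 0 T → g x = 0) :
    Integrable g ∧ ∀ t, ‖∫ x in (0:ℝ)..t, g x‖ ≤ B * T := by
  have hi : Integrable ((Set.Icc 0 T).indicator fun _ => B) :=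
    (integrable_indicator_iff measurableSet_Icc).2 (by simp)
  have hle : ∀ x, ‖g x‖ ≤ (Set.Icc 0 T).indicator (fun _ => B) x := by
    intro x
    by_cases hx : x ∈ Set.Icc 0 T
    · rw [Set.indicator_of_mem hx]; exact hB x
    · rw [Set.indicator_of_notMem hx, h0 x hx, norm_zero]
  have hgi : Integrable g :=
    hi.mono' hg.aestronglyMeasurable (Filter.Eventually.of_forall hle)
  refine ⟨hgi, fun t => ?_⟩
  refine (intervalIntegral.norm_integral_le_integral_norm_uIoc).trans ?_
  refine (setIntegral_le_integral hgi.norm (Filter.Eventually.of_forall fun _ => norm_nonneg _)).trans ?_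
  refine (integral_mono hgi.norm hi hle).trans ?_
  rw [integral_indicator measurableSet_Icc]
  simp [hT.le, mul_comm]

lemma aux_exists (T : ℝ) (hT : 0 < T) (F : ℝ → ℂ → ℂ) (δ L : ℝ) (hδ : 0 < δ) (hL : 0 ≤ L)
    (hLT : L * T ≤ 1 / 2) (hF0 : ∀ x, F x 0 = 0) (hFn : ∀ x z, x ∉ Set.Icc 0 T → F x z = 0)
    (hF : ∀ x z w, ‖z‖ ≤ δ → ‖w‖ ≤ δ → ‖F x z - F x w‖ ≤ L * ‖z - w‖)
    (hm : ∀ u : ℝ → ℂ, Continuous u → (∀ x, ‖u x‖ ≤ δ) → Measurable fun x => F x (u x))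
    (r : ℂ) (hr : ‖r‖ ≤ δ / 2) :
    ∃ v : ℝ → ℂ, Continuous v ∧ (∀ x, ‖v x‖ ≤ δ) ∧
      ∀ t, v t = r + ∫ x in (0:ℝ)..t, F x (v x) := by
  let S := Metric.closedBall (0 : BoundedContinuousFunction ℝ ℂ) δ
  have hSn : ∀ u : S, ∀ x, ‖u.1 x‖ ≤ δ := fun u x =>
    (u.1.norm_coe_le_norm x).trans (mem_closedBall_zero_iff.1 u.2)
  have hFb : ∀ x z, ‖z‖ ≤ δ → ‖F x z‖ ≤ L * δ := by
    intro x z hz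
    have := hF x z 0 hz (by simpa using hδ.le)
    rw [hF0, sub_zero, sub_zero] at this
    exact this.trans (by gcongr)
  have hI : ∀ u : S, Integrable (fun x => F x (u.1 x)) ∧
      ∀ t, ‖∫ x in (0:ℝ)..t, F x (u.1 x)‖ ≤ (L * δ) * T := fun u =>
    aux_int_s4 T hT _ (hm _ u.1.continuous (hSn u)) (L * δ) (fun x => hFb x _ (hSn u x))
      (fun x hx => hFn x _ hx)
  have hbound : ∀ u : S, ∀ t, ‖r + ∫ x in (0:ℝ)..t, F x (u.1 x)‖ ≤ δ := by
    intro u t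
    refine (norm_add_le _ _).trans ?_
    have := (hI u).2 t
    nlinarith
  have hcont : ∀ u : S, Continuous fun t => r + ∫ x in (0:ℝ)..t, F x (u.1 x) := fun u =>
    continuous_const.add
      (intervalIntegral.continuous_primitive (fun _ _ => (hI u).1.intervalIntegrable) 0)
  let Φ : S → S := fun u =>
    ⟨BoundedContinuousFunction.ofNormedAddCommGroup _ (hcont u) δ (hbound u), by
      rw [mem_closedBall_zero_iff]
      exact BoundedContinuousFunction.norm_ofNormedAddCommGroup_le _ hδ.le _⟩
  have hΦ : ContractingWith (1 / 2) Φ := by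
    refine ⟨by rw [← NNReal.coe_lt_coe]; norm_num, LipschitzWith.of_dist_le_mul ?_⟩
    intro u w
    rw [Subtype.dist_eq, Subtype.dist_eq, BoundedContinuousFunction.dist_le (by positivity)]
    intro t
    show dist (r + ∫ x in (0:ℝ)..t, F x (u.1 x)) (r + ∫ x in (0:ℝ)..t, F x (w.1 x)) ≤ _
    rw [dist_add_left, dist_eq_norm, ← intervalIntegral.integral_sub
      (hI u).1.intervalIntegrable (hI w).1.intervalIntegrable]
    refine ((aux_int_s4 T hT _ ((hm _ u.1.continuous (hSn u)).sub (hm _ w.1.continuous (hSn w)))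
      (L * dist u.1 w.1) ?_ ?_).2 t).trans ?_
    · intro x
      refine (hF x _ _ (hSn u x) (hSn w x)).trans ?_
      rw [← dist_eq_norm]
      gcongr
      exact BoundedContinuousFunction.dist_coe_le_dist x
    · intro x hx
      simp [hFn x _ hx]
    · have : 0 ≤ dist u.1 w.1 := dist_nonneg
      push_cast
      nlinarith
  have : CompleteSpace S := Metric.isClosed_closedBall.completeSpace_coe
  have : Nonempty S := ⟨⟨0, Metric.mem_closedBall_self hδ.le⟩⟩
  have hfix := hΦ.fixedPoint_isFixedPt
  set v := ContractingWith.fixedPoint Φ hΦ with hv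
  refine ⟨v.1, v.1.continuous, hSn v, fun t => ?_⟩
  have h1 : (Φ v).1 t = v.1 t := by rw [hfix]
  exact h1.symm

/-- for every `a ∈ X` there is `ε > 0` such that for each initial value `r`
with `|r| < ε` there is a unique Lipschitz solution of `v' = ∑_{i≥1} aᵢ(x) v^{i+1}`,
`v(0) = r`, on `[0,T]`. -/
theorem exists_unique_solution (T : ℝ) (hT : 0 < T) (a : ℕ → ℝ → ℂ) (ha : MemX T a) :
    ∃ ε > (0 : ℝ), ∀ r : ℂ, ‖r‖ < ε →
      ∃ v : ℝ → ℂ, v 0 = r ∧ IsODESol T a v ∧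
        ∀ w : ℝ → ℂ, w 0 = r → IsODESol T a w → Set.EqOn w v (Set.Icc 0 T) := by
  obtain ⟨δ, hδ, L, hL, hLT, hsum, hLip⟩ := auxF_props T hT a ha
  have hFb : ∀ x z, ‖z‖ ≤ δ → ‖auxF T a x z‖ ≤ L * δ := by
    intro x z hz
    have := hLip x z 0 hz (by simpa using hδ.le)
    rw [auxF_zero, sub_zero, sub_zero] at this
    exact this.trans (by gcongr)
  refine ⟨δ / 2, by positivity, fun r hr => ?_⟩
  obtain ⟨v, hvc, hvb, hv⟩ := aux_exists T hT (auxF T a) δ L hδ hL hLT (auxF_zero T a)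
    (fun x z hx => auxF_of_notMem T a x z hx) hLip
    (fun u hu hub => auxF_meas T a ha u hu fun x => hsum x _ (hub x)) r hr.le
  have hgi : Integrable (fun x => auxF T a x (v x)) :=
    (aux_int_s4 T hT _ (auxF_meas T a ha v hvc fun x => hsum x _ (hvb x)) (L * δ)
      (fun x => hFb x _ (hvb x)) (fun x hx => auxF_of_notMem T a x _ hx)).1
  have hv0 : v 0 = r := by rw [hv 0]; simp
  have hvlip : LipschitzOnWith (Real.toNNReal (L * δ)) v (Set.Icc 0 T) := by
    refine LipschitzOnWith.of_dist_le_mul fun x _ y _ => ?_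
    rw [Real.coe_toNNReal _ (by positivity), dist_eq_norm, hv x, hv y, add_sub_add_left_eq_sub,
      intervalIntegral.integral_interval_sub_left hgi.intervalIntegrable hgi.intervalIntegrable,
      Real.dist_eq]
    exact intervalIntegral.norm_integral_le_of_norm_le_const fun x _ => hFb x _ (hvb x)
  have hvd : ∀ᵐ x, HasDerivAt v (auxF T a x (v x)) x := by
    filter_upwards [LocallyIntegrable.ae_hasDerivAt_integral hgi.locallyIntegrable] with x hx
    have h1 := (hx 0).const_add r
    have h2 : v = fun t => r + ∫ x in (0:ℝ)..t, auxF T a x (v x) := funext hv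
    rwa [← h2] at h1
  refine ⟨v, hv0, ⟨⟨_, hvlip⟩, ?_⟩, ?_⟩
  · rw [ae_restrict_iff' measurableSet_Icc]
    filter_upwards [hvd] with x hx hxi
    rw [← auxF_of_mem T a x _ hxi]
    refine ⟨?_, hx⟩
    simpa only [Set.indicator_of_mem hxi] using hsum x (v x) (hvb x)
  · rintro w hw0 ⟨⟨K, hwl⟩, hwd⟩
    rw [ae_restrict_iff' measurableSet_Icc] at hwd
    have hwc : ContinuousOn w (Set.Icc 0 T) := hwl.continuousOn
    have hwb : ∀ t ∈ Set.Icc 0 T, ‖w t‖ < δ := by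
      by_contra hcon
      push Not at hcon
      obtain ⟨t1, ht1, ht1b⟩ := hcon
      have hcl : IsCompact (Set.Icc 0 T ∩ (fun t => ‖w t‖) ⁻¹' Set.Ici δ) :=
        isCompact_Icc.of_isClosed_subset
          (hwc.norm.preimage_isClosed_of_isClosed isClosed_Icc isClosed_Ici) Set.inter_subset_left
      obtain ⟨t0, ⟨ht0, ht0b⟩, hmin⟩ := hcl.exists_isLeast ⟨t1, ht1, ht1b⟩
      have hlt : ∀ s ∈ Set.Ioo 0 t0, ‖w s‖ ≤ δ := by
        intro s hs
        by_contra hc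
        have := hmin ⟨⟨hs.1.le, hs.2.le.trans ht0.2⟩, (not_le.1 hc).le⟩
        exact absurd hs.2 (not_lt.2 this)
      have h1 := aux_mvt w t0 (L * δ) ht0.1 K
        (hwl.mono (Set.Icc_subset_Icc_right ht0.2)) (fun x => auxF T a x (w x)) (by
          filter_upwards [hwd] with x hx hxi
          have hxT : x ∈ Set.Icc 0 T := ⟨hxi.1.le, hxi.2.le.trans ht0.2⟩
          refine ⟨?_, hFb x _ (hlt x hxi)⟩
          rw [auxF_of_mem T a x _ hxT]
          exact (hx hxT).2)
      have h2 : ‖w t0‖ ≤ ‖w t0 - w 0‖ + ‖w 0‖ := by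
        simpa using norm_add_le (w t0 - w 0) (w 0)
      rw [hw0] at h1 h2
      have h3 : δ ≤ ‖w t0‖ := ht0b
      have h4 : L * δ * t0 ≤ L * δ * T := by gcongr; exact ht0.2
      nlinarith
    obtain ⟨t0, ht0, hmax⟩ := isCompact_Icc.exists_isMaxOn (Set.nonempty_Icc.2 hT.le)
      ((hwc.sub hvc.continuousOn).norm)
    set m := ‖w t0 - v t0‖ with hm
    have hle : ∀ t ∈ Set.Icc 0 T, ‖w t - v t‖ ≤ m := fun t ht => hmax ht
    have h1 := aux_mvt (fun t => w t - v t) t0 (L * m) ht0.1 (K + Real.toNNReal (L * δ))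
      ((hwl.sub hvlip).mono (Set.Icc_subset_Icc_right ht0.2))
      (fun x => auxF T a x (w x) - auxF T a x (v x)) (by
        filter_upwards [hwd, hvd] with x hx hx2 hxi
        have hxT : x ∈ Set.Icc 0 T := ⟨hxi.1.le, hxi.2.le.trans ht0.2⟩
        refine ⟨?_, ?_⟩
        · refine HasDerivAt.sub ?_ hx2
          rw [auxF_of_mem T a x _ hxT]
          exact (hx hxT).2
        · refine (hLip x _ _ (hwb x hxT).le (hvb x)).trans ?_
          gcongr
          exact hle x hxT)
    simp only [hw0, hv0, sub_self, sub_zero] at h1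
    have hm0 : 0 ≤ m := norm_nonneg _
    have h4 : L * m * t0 ≤ L * m * T := by gcongr; exact ht0.2
    have hmz : m ≤ 0 := by nlinarith
    intro t ht
    have h5 := (hle t ht).trans hmz
    exact sub_eq_zero.1 (norm_le_zero_iff.1 h5)
end
end

section
/- (Center criterion, evaluated form.) An element a ∈ X determines a center if and only if for every i ≥ 1 one has ∑_{i_1+⋯+i_k=i} p_{i_1,…,i_k}(i) · I_{i_1,…,i_k}(a) = 0, where the sum is over all multi-indices of positive integers with i_1+⋯+i_k=i. -/
open MeasureTheory

noncomputable section

/-- The value `p_{i₁,…,iₖ}(t) = (t-i₁+1)(t-i₁-i₂+1)⋯(t-i₁-⋯-iₖ+1)` for the multi-index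
`l = [i₁,…,iₖ]`. -/
def pval (l : List ℕ) (t : ℂ) : ℂ :=
  ∏ j ∈ Finset.range l.length, (t - ((l.take (j + 1)).sum : ℂ) + 1)


/-- `a ∈ X` determines a center: there is `ε > 0` such that every Lipschitz solution `v` of
`v' = ∑_{i≥1} aᵢ(x) v^{i+1}` on `[0,T]` with `|v(0)| < ε` satisfies `v(T) = v(0)`. -/
def IsCenter (T : ℝ) (a : ℕ → ℝ → ℂ) : Prop :=
  ∃ ε > (0 : ℝ), ∀ v : ℝ → ℂ, ‖v 0‖ < ε → IsODESol T a v → v T = v 0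


def qc : ℕ → List ℕ → ℂ
  | _, [] => 1
  | m, i :: l => (m : ℂ) * qc (m + i) l

def cc (a : ℕ → ℝ → ℂ) (m n : ℕ) (x : ℝ) : ℂ :=
  ∑ c : Composition n, qc m c.blocks * itIntAux a c.blocks x

lemma qc_snoc (l : List ℕ) (i m : ℕ) : qc m (l ++ [i]) = qc m l * ((m : ℂ) + l.sum) := by
  induction l generalizing m with
  | nil => simp [qc]
  | cons j l ih =>
    simp only [List.cons_append, qc, ih, List.sum_cons]
    push_cast; ring

lemma pval_cons (i : ℕ) (l : List ℕ) (t : ℂ) :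
    pval (i :: l) t = (t - i + 1) * pval l (t - i) := by
  unfold pval
  rw [List.length_cons, Finset.prod_range_succ', mul_comm]
  have h1 : ∀ j ∈ Finset.range l.length, t - (((i :: l).take (j + 1 + 1)).sum : ℂ) + 1 =
      t - i - ((l.take (j + 1)).sum : ℂ) + 1 := by
    intro j _
    simp [List.take_succ_cons]; ring
  rw [Finset.prod_congr rfl h1]
  simp

lemma qc_reverse (r : List ℕ) : qc 1 r.reverse = pval r (r.sum : ℂ) := by
  induction r with
  | nil => simp [qc, pval]
  | cons i r ih =>
    rw [List.reverse_cons, qc_snoc, ih, pval_cons]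
    simp; ring

lemma sum_eq_cc (T : ℝ) (a : ℕ → ℝ → ℂ) (n : ℕ) :
    ∑ comp : Composition n, pval comp.blocks (n : ℂ) * itInt T a comp.blocks = cc a 1 n T := by
  unfold cc
  refine Finset.sum_bij' (fun c _ => c.reverse) (fun c _ => c.reverse) ?_ ?_ ?_ ?_ ?_
  · simp
  · simp
  · simp
  · simp
  · intro c _
    have := qc_reverse c.blocks
    rw [c.blocks_sum] at this
    simp only [Composition.reverse, itInt]
    rw [this]

def consComp (n : ℕ) (i : ℕ) (hi : i ≤ n) (c : Composition (n - i)) : Composition (n + 1) where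
  blocks := (i + 1) :: c.blocks
  blocks_pos := by
    intro j hj
    rcases List.mem_cons.1 hj with rfl | h
    · omega
    · exact c.blocks_pos h
  blocks_sum := by simp [c.blocks_sum]; omega

lemma sum_comp_cons (f : List ℕ → ℂ) (n : ℕ) :
    ∑ c : Composition (n + 1), f c.blocks =
      ∑ i ∈ Finset.range (n + 1), ∑ c : Composition (n - i), f ((i + 1) :: c.blocks) := by
  rw [Finset.sum_sigma']
  symm
  refine Finset.sum_bij (fun p hp => consComp n p.1 (by simp at hp; omega) p.2) ?_ ?_ ?_ ?_
  · simp
  · rintro ⟨i, c⟩ h ⟨j, d⟩ h' e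
    have e' := congrArg Composition.blocks e
    simp only [consComp, List.cons.injEq, Nat.add_right_cancel_iff] at e'
    obtain ⟨rfl, e2⟩ := e'
    have : c = d := Composition.ext e2
    rw [this]
  · intro c _
    obtain ⟨bl, hp, hs⟩ := c
    cases bl with
    | nil => simp at hs
    | cons j l =>
      have hj : 0 < j := hp (by simp)
      have hs' : j + l.sum = n + 1 := by simpa using hs
      refine ⟨⟨j - 1, ⟨l, fun h => hp (by simp [h]), by omega⟩⟩, by simp; omega, ?_⟩
      apply Composition.ext
      simp only [consComp]
      congr 1; omega
  · intro p hp; rfl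

lemma cc_zero (a : ℕ → ℝ → ℂ) (m : ℕ) (x : ℝ) : cc a m 0 x = 1 := by
  have key : ∀ c : Composition 0, c.blocks = [] := by
    intro c
    obtain ⟨bl, hp, hs⟩ := c
    cases bl with
    | nil => rfl
    | cons j l =>
      have := hp (i := j) (by simp)
      simp at hs
      omega
  have hs : Subsingleton (Composition 0) :=
    ⟨fun c d => Composition.ext ((key c).trans (key d).symm)⟩
  unfold cc
  rw [Fintype.sum_subsingleton _ (default : Composition 0), key]
  simp [qc, itIntAux]

structure Bd (T C : ℝ) (a : ℕ → ℝ → ℂ) : Prop where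
  hT : 0 ≤ T
  hC : 0 < C
  meas : ∀ i, Measurable (a i)
  bd : ∀ i, ∀ x ∈ Set.Icc (0 : ℝ) T, ‖a (i + 1) x‖ ≤ C ^ (i + 1)

lemma Bd.intI {T C : ℝ} {a : ℕ → ℝ → ℂ} (h : Bd T C a) (i : ℕ) (w : ℝ → ℂ)
    (hw : ContinuousOn w (Set.Icc 0 T)) {x : ℝ} (hx : x ∈ Set.Icc (0 : ℝ) T) :
    IntervalIntegrable (fun s => a (i + 1) s * w s) volume 0 x := by
  have h1 : IntervalIntegrable (a (i + 1)) volume 0 x := by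
    rw [intervalIntegrable_iff, Set.uIoc_of_le hx.1]
    refine Measure.integrableOn_of_bounded (M := C ^ (i + 1)) (by simp)
      (h.meas _).aestronglyMeasurable ?_
    rw [ae_restrict_iff' measurableSet_Ioc]
    exact Filter.Eventually.of_forall fun y hy => h.bd i y ⟨hy.1.le, hy.2.trans hx.2⟩
  apply h1.mul_continuousOn
  rw [Set.uIcc_of_le hx.1]
  exact hw.mono (Set.Icc_subset_Icc_right hx.2)

lemma Bd.cont_aux {T C : ℝ} {a : ℕ → ℝ → ℂ} (h : Bd T C a) (l : List ℕ) (hl : ∀ i ∈ l, 0 < i) :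
    ContinuousOn (itIntAux a l) (Set.Icc 0 T) := by
  induction l with
  | nil => 
    have : itIntAux a [] = fun _ => 1 := by funext x; simp [itIntAux]
    rw [this]; exact continuousOn_const
  | cons i l ih =>
    have ih' := ih (fun j hj => hl j (by simp [hj]))
    obtain ⟨k, rfl⟩ : ∃ k, i = k + 1 := ⟨i - 1, by have := hl i (by simp); omega⟩
    have : itIntAux a ((k + 1) :: l) = fun x => ∫ s in (0 : ℝ)..x, a (k + 1) s * itIntAux a l s := by
      funext x; simp [itIntAux]
    rw [this]
    have h2 := h.intI k _ ih' (x := T) ⟨h.hT, le_rfl⟩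
    have := intervalIntegral.continuousOn_primitive_interval' h2 (a := 0) (by simp)
    rwa [Set.uIcc_of_le h.hT] at this

lemma Bd.cont_cc {T C : ℝ} {a : ℕ → ℝ → ℂ} (h : Bd T C a) (m n : ℕ) :
    ContinuousOn (cc a m n) (Set.Icc 0 T) := by
  unfold cc
  refine continuousOn_finsetSum _ fun c _ => continuousOn_const.mul (h.cont_aux _ ?_)
  intro i hi; exact c.blocks_pos hi

lemma Bd.cc_succ {T C : ℝ} {a : ℕ → ℝ → ℂ} (h : Bd T C a) (m n : ℕ) {x : ℝ}
    (hx : x ∈ Set.Icc (0 : ℝ) T) :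
    cc a m (n + 1) x = ∑ i ∈ Finset.range (n + 1),
      (m : ℂ) * ∫ s in (0 : ℝ)..x, a (i + 1) s * cc a (m + i + 1) (n - i) s := by
  rw [cc, sum_comp_cons (fun l => qc m l * itIntAux a l x)]
  refine Finset.sum_congr rfl fun i _ => ?_
  simp only [cc, Finset.mul_sum]
  rw [intervalIntegral.integral_finsetSum]
  · rw [Finset.mul_sum]
    refine Finset.sum_congr rfl fun c _ => ?_
    simp only [qc, itIntAux]
    rw [← add_assoc, mul_assoc, ← intervalIntegral.integral_const_mul]
    congr 1
    refine intervalIntegral.integral_congr fun s _ => ?_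
    ring
  · intro c _
    exact h.intI i _ (continuousOn_const.mul (h.cont_aux _ fun i hi => c.blocks_pos hi)) hx

def SS (a : ℕ → ℝ → ℂ) (m N : ℕ) (r : ℂ) (x : ℝ) : ℂ :=
  ∑ n ∈ Finset.range N, cc a m n x * r ^ (n + m)

lemma Bd.cont_SS {T C : ℝ} {a : ℕ → ℝ → ℂ} (h : Bd T C a) (m N : ℕ) (r : ℂ) :
    ContinuousOn (SS a m N r) (Set.Icc 0 T) := by
  unfold SS
  exact continuousOn_finsetSum _ fun n _ => (h.cont_cc m n).mul continuousOn_const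

lemma Bd.SS_succ {T C : ℝ} {a : ℕ → ℝ → ℂ} (h : Bd T C a) (m N : ℕ) (r : ℂ) {x : ℝ}
    (hx : x ∈ Set.Icc (0 : ℝ) T) :
    SS a m (N + 1) r x = r ^ m + ∫ s in (0 : ℝ)..x,
      (m : ℂ) * ∑ i ∈ Finset.range N, a (i + 1) s * SS a (m + i + 1) (N - i) r s := by
  rw [intervalIntegral.integral_const_mul, intervalIntegral.integral_finsetSum
    (fun i _ => h.intI i _ (h.cont_SS _ _ _) hx), SS, Finset.sum_range_succ', cc_zero, add_comm]
  congr 1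
  · simp
  simp only [SS, Finset.mul_sum]
  have e : ∀ i ∈ Finset.range N, (m : ℂ) * (∫ s in (0 : ℝ)..x, ∑ n ∈ Finset.range (N - i),
        a (i + 1) s * (cc a (m + i + 1) n s * r ^ (n + (m + i + 1)))) =
      ∑ n ∈ Finset.range (N - i), (m : ℂ) * (∫ s in (0 : ℝ)..x,
        a (i + 1) s * cc a (m + i + 1) n s) * r ^ (n + (m + i + 1)) := by
    intro i _
    rw [intervalIntegral.integral_finsetSum
      (fun n _ => h.intI i (fun s => cc a (m + i + 1) n s * r ^ (n + (m + i + 1)))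
        ((h.cont_cc _ _).mul continuousOn_const) hx), Finset.mul_sum]
    refine Finset.sum_congr rfl fun n _ => ?_
    rw [mul_assoc, ← intervalIntegral.integral_mul_const]
    congr 1
    refine intervalIntegral.integral_congr fun s _ => ?_
    ring
  rw [Finset.sum_congr rfl e, ← Finset.sum_range_diag_flip N (fun i n => (m : ℂ) *
    (∫ s in (0 : ℝ)..x, a (i + 1) s * cc a (m + i + 1) n s) * r ^ (n + (m + i + 1)))]
  refine Finset.sum_congr rfl fun n _ => ?_
  rw [h.cc_succ m n hx, Finset.sum_mul]
  refine Finset.sum_congr rfl fun i hi => ?_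
  congr 2
  simp at hi; omega

lemma lip_prim {t B : ℝ} {g : ℝ → ℂ} (hg : IntervalIntegrable g volume 0 t)
    (hB : ∀ x ∈ Set.Ioc 0 t, ‖g x‖ ≤ B) (hB0 : 0 ≤ B) :
    LipschitzOnWith B.toNNReal (fun x => ∫ s in (0 : ℝ)..x, g s) (Set.Icc 0 t) := by
  refine LipschitzOnWith.of_dist_le_mul fun x hx y hy => ?_
  have ht : 0 ≤ t := hx.1.trans hx.2
  have i1 : ∀ z ∈ Set.Icc 0 t, IntervalIntegrable g volume 0 z := fun z hz =>
    hg.mono_set (by rw [Set.uIcc_of_le ht, Set.uIcc_of_le hz.1]; exact Set.Icc_subset_Icc_right hz.2)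
  rw [dist_eq_norm, intervalIntegral.integral_interval_sub_left (i1 x hx) (i1 y hy),
    Real.coe_toNNReal _ hB0, Real.dist_eq]
  refine intervalIntegral.norm_integral_le_of_norm_le_const fun z hz => hB z ?_
  rw [Set.mem_uIoc] at hz
  rcases hz with hz | hz
  · exact ⟨hy.1.trans_lt hz.1, hz.2.trans hx.2⟩
  · exact ⟨hx.1.trans_lt hz.1, hz.2.trans hy.2⟩

lemma ftc {t B : ℝ} (ht : 0 ≤ t) {v g : ℝ → ℂ} (h2 : AbsolutelyContinuousOnInterval v 0 t)
    (hg : IntervalIntegrable g volume 0 t) (hB : ∀ x ∈ Set.Ioc 0 t, ‖g x‖ ≤ B) (hB0 : 0 ≤ B)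
    (hd : ∀ᵐ x, x ∈ Set.Icc 0 t → HasDerivAt v (g x) x) :
    v t = v 0 + ∫ s in (0 : ℝ)..t, g s := by
  have h1 : AbsolutelyContinuousOnInterval (fun x => ∫ s in (0 : ℝ)..x, g s) 0 t :=
    LipschitzOnWith.absolutelyContinuousOnInterval
      (by rw [Set.uIcc_of_le ht]; exact lip_prim hg hB hB0)
  have h3 := h2.sub h1
  obtain ⟨c, hc⟩ := h3.const_of_ae_hasDerivAt_zero (by
    filter_upwards [hd, hg.ae_hasDerivAt_integral] with x hx₁ hx₂ hx₃
    have := (hx₁ (by rwa [← Set.uIcc_of_le ht])).sub (hx₂ hx₃ 0 (by simp))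
    rw [sub_self] at this
    exact this)
  have e1 := hc 0 (by simp)
  have e2 := hc t (by simp)
  simp at e1 e2
  rw [← e1] at e2
  linear_combination e2

lemma tsum_int {t B : ℝ} (ht : 0 ≤ t) (f : ℕ → ℝ → ℂ)
    (hm : ∀ i, AEStronglyMeasurable (f i) (volume.restrict (Set.Ioc 0 t)))
    (hb : ∀ i, ∀ x ∈ Set.Ioc 0 t, ‖f i x‖ ≤ B * (1 / 2) ^ (i + 1)) :
    IntervalIntegrable (fun x => ∑' i, f i x) volume 0 t ∧
    ∀ x ∈ Set.Ioc 0 t, Summable (fun i => ‖f i x‖) ∧ ‖∑' i, f i x‖ ≤ B := by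
  have hs : HasSum (fun i : ℕ => B * (1 / 2 : ℝ) ^ (i + 1)) B := by
    have := (hasSum_geometric_two.mul_left (B * (1 / 2)))
    have e : (fun i : ℕ => B * (1 / 2 : ℝ) ^ (i + 1)) = fun i => B * (1 / 2) * (1 / 2) ^ i := by
      funext i; ring
    rw [e]
    have e2 : B * (1 / 2) * 2 = B := by ring
    rwa [e2] at this
  have key : ∀ x ∈ Set.Ioc 0 t, Summable (fun i => ‖f i x‖) ∧ ‖∑' i, f i x‖ ≤ B := fun x hx =>
    ⟨Summable.of_nonneg_of_le (fun _ => norm_nonneg _) (fun i => hb i x hx) hs.summable,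
      tsum_of_norm_bounded hs (fun i => hb i x hx)⟩
  refine ⟨?_, key⟩
  rw [intervalIntegrable_iff, Set.uIoc_of_le ht]
  have hmm : AEMeasurable (fun x => ∑' i, f i x) (volume.restrict (Set.Ioc 0 t)) :=
    AEMeasurable.tsum fun i => (hm i).aemeasurable
  refine Integrable.of_bound hmm.aestronglyMeasurable B ?_
  rw [ae_restrict_iff' measurableSet_Ioc]
  exact Filter.Eventually.of_forall fun y hy => (key y hy).2

def GG (a : ℕ → ℝ → ℂ) (m : ℕ) (w : ℝ → ℂ) (x : ℝ) : ℂ :=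
  ∑' i : ℕ, a (i + 1) x * w x ^ (m + i + 1)

lemma Bd.GG_int {T C : ℝ} {a : ℕ → ℝ → ℂ} (h : Bd T C a) (m : ℕ) {w : ℝ → ℂ} {t R : ℝ}
    (ht : t ∈ Set.Icc 0 T) (hw : ContinuousOn w (Set.Icc 0 t)) (hR : 0 ≤ R) (hCR : 2 * C * R ≤ 1)
    (hwR : ∀ x ∈ Set.Icc 0 t, ‖w x‖ ≤ R) :
    IntervalIntegrable (GG a m w) volume 0 t ∧ ∀ x ∈ Set.Ioc 0 t,
      Summable (fun i => ‖a (i + 1) x * w x ^ (m + i + 1)‖) ∧ ‖GG a m w x‖ ≤ R ^ m * (2 * C * R) := by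
  have hC := h.hC
  refine tsum_int ht.1 (fun i x => a (i + 1) x * w x ^ (m + i + 1)) ?_ ?_
  · intro i
    refine ((h.meas _).aestronglyMeasurable).mul (AEStronglyMeasurable.pow ?_ _)
    exact (hw.mono Set.Ioc_subset_Icc_self).aestronglyMeasurable measurableSet_Ioc
  · intro i x hx
    rw [norm_mul, norm_pow]
    calc ‖a (i + 1) x‖ * ‖w x‖ ^ (m + i + 1) ≤ C ^ (i + 1) * R ^ (m + i + 1) := by
          gcongr
          · exact h.bd i x ⟨hx.1.le, hx.2.trans ht.2⟩
          · exact hwR x ⟨hx.1.le, hx.2⟩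
      _ = R ^ m * (2 * C * R) ^ (i + 1) * (1 / 2) ^ (i + 1) := by
          rw [mul_assoc, ← mul_pow, show 2 * C * R * (1 / 2) = C * R by ring, mul_pow]; ring
      _ ≤ R ^ m * (2 * C * R) * (1 / 2) ^ (i + 1) := by
          gcongr
          exact pow_le_of_le_one (by positivity) hCR (by omega)

lemma ac_pow {t : ℝ} {v : ℝ → ℂ} (h : AbsolutelyContinuousOnInterval v 0 t) (m : ℕ) :
    AbsolutelyContinuousOnInterval (fun x => v x ^ m) 0 t := by
  induction m with
  | zero =>
    simp only [pow_zero]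
    exact (LipschitzWith.const (1 : ℂ)).lipschitzOnWith.absolutelyContinuousOnInterval
  | succ m ih =>
    simp only [pow_succ]
    exact ih.smul h

lemma Bd.sol_int {T C : ℝ} {a : ℕ → ℝ → ℂ} (h : Bd T C a) (m : ℕ) {v : ℝ → ℂ}
    (hv : IsODESol T a v) {t R : ℝ}
    (ht : t ∈ Set.Icc 0 T) (hR : 0 ≤ R) (hCR : 2 * C * R ≤ 1)
    (hvR : ∀ x ∈ Set.Icc 0 t, ‖v x‖ ≤ R) :
    v t ^ m = v 0 ^ m + ∫ s in (0 : ℝ)..t, (m : ℂ) * GG a m v s := by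
  obtain ⟨⟨K, hK⟩, hd⟩ := hv
  have hC := h.hC
  have hK' := hK.mono (Set.Icc_subset_Icc_right ht.2)
  obtain ⟨hi, hb⟩ := h.GG_int m ht hK'.continuousOn hR hCR hvR
  have hac : AbsolutelyContinuousOnInterval v 0 t :=
    LipschitzOnWith.absolutelyContinuousOnInterval (by rwa [Set.uIcc_of_le ht.1])
  refine ftc (B := m * (R ^ m * (2 * C * R))) ht.1 (v := fun x => v x ^ m) (ac_pow hac m)
    (hi.const_mul _) ?_ (by positivity) ?_
  · intro x hx
    rw [norm_mul, Complex.norm_natCast]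
    gcongr
    exact (hb x hx).2
  · rw [ae_restrict_iff' measurableSet_Icc] at hd
    filter_upwards [hd] with x hx hxt
    obtain ⟨-, hx2⟩ := hx ⟨hxt.1, hxt.2.trans ht.2⟩
    have := hx2.pow m
    refine this.congr_deriv ?_
    cases m with
    | zero => simp
    | succ m =>
      rw [mul_assoc, GG, Nat.add_sub_cancel, ← tsum_mul_left]
      congr 1
      refine tsum_congr fun i => ?_
      ring

lemma Bd.apriori {T C : ℝ} {a : ℕ → ℝ → ℂ} (h : Bd T C a) {v : ℝ → ℂ}
    (hv : IsODESol T a v) {R : ℝ} (hR : 0 < R) (hCR : 2 * C * R ≤ 1)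
    (hTR : 2 * C * R * T ≤ 1 / 4) (h0 : ‖v 0‖ ≤ R / 2) :
    ∀ x ∈ Set.Icc 0 T, ‖v x‖ ≤ R := by
  by_contra! hcon
  obtain ⟨x, hx, hxR⟩ := hcon
  have hC := h.hC
  obtain ⟨⟨K, hK⟩, -⟩ := id hv
  have hc : ContinuousOn (fun x => ‖v x‖) (Set.Icc 0 T) := hK.continuousOn.norm
  have ivt : ∀ y ∈ Set.Icc 0 T, R ≤ ‖v y‖ → ∃ z ∈ Set.Icc 0 y, ‖v z‖ = R := by
    intro y hy hyR
    have := intermediate_value_Icc hy.1 (hc.mono (Set.Icc_subset_Icc_right hy.2))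
    exact this ⟨by linarith, hyR⟩
  have hcomp : IsCompact (Set.Icc 0 T ∩ (fun x => ‖v x‖) ⁻¹' {R}) := by
    have := hc.preimage_isClosed_of_isClosed isClosed_Icc (isClosed_singleton (x := R))
    exact isCompact_Icc.of_isClosed_subset this Set.inter_subset_left
  obtain ⟨z, hz, hzR⟩ := ivt x hx hxR.le
  obtain ⟨t, ht, hmin⟩ := hcomp.exists_isLeast ⟨z, ⟨hz.1, hz.2.trans hx.2⟩, hzR⟩
  have htR : ‖v t‖ = R := ht.2
  have hle : ∀ y ∈ Set.Icc 0 t, ‖v y‖ ≤ R := by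
    intro y hy
    by_contra! hlt
    have hyT : y ∈ Set.Icc 0 T := ⟨hy.1, hy.2.trans ht.1.2⟩
    obtain ⟨z, hz, hzR⟩ := ivt y hyT hlt.le
    have : t ≤ z := hmin ⟨⟨hz.1, hz.2.trans hyT.2⟩, hzR⟩
    have : y = t := le_antisymm hy.2 (this.trans hz.2)
    rw [this, htR] at hlt
    exact lt_irrefl _ hlt
  have e := h.sol_int 1 hv ht.1 hR.le hCR hle
  obtain ⟨-, hb⟩ := h.GG_int 1 ht.1 (hK.continuousOn.mono (Set.Icc_subset_Icc_right ht.1.2))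
    hR.le hCR hle
  simp only [pow_one, Nat.cast_one, one_mul] at e hb
  have n1 : ‖∫ s in (0 : ℝ)..t, GG a 1 v s‖ ≤ R * (2 * C * R) * |t - 0| := by
    refine intervalIntegral.norm_integral_le_of_norm_le_const fun s hs => ?_
    rw [Set.uIoc_of_le ht.1.1] at hs
    exact (hb s hs).2
  rw [sub_zero, abs_of_nonneg ht.1.1] at n1
  have n2 : R * (2 * C * R) * t ≤ R * (1 / 4) := by
    calc R * (2 * C * R) * t ≤ R * (2 * C * R) * T := by gcongr; exact ht.1.2
      _ = R * (2 * C * R * T) := by ring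
      _ ≤ _ := by gcongr
  have n3 : ‖v t‖ ≤ ‖v 0‖ + ‖∫ s in (0 : ℝ)..t, GG a 1 v s‖ := by
    rw [e]; exact norm_add_le _ _
  linarith

lemma Bd.main_bound {T C : ℝ} {a : ℕ → ℝ → ℂ} (h : Bd T C a) {v : ℝ → ℂ}
    (hv : IsODESol T a v) {R : ℝ} (hR : 0 ≤ R) (hq : 2 * C * R * Real.exp T ≤ 1)
    (hvR : ∀ x ∈ Set.Icc 0 T, ‖v x‖ ≤ R) (N : ℕ) : ∀ m : ℕ, ∀ x ∈ Set.Icc 0 T,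
    ‖v x ^ m - SS a m N (v 0) x‖ ≤ (2 * C * R * Real.exp T) ^ N * R ^ m * Real.exp (m * x) := by
  have hC := h.hC
  have hCR : 2 * C * R ≤ 1 := by
    refine le_trans ?_ hq
    exact le_mul_of_one_le_right (by positivity) (Real.one_le_exp h.hT)
  obtain ⟨⟨K, hK⟩, -⟩ := id hv
  set q := 2 * C * R * Real.exp T with hqdef
  have hq0 : 0 ≤ q := by positivity
  induction N using Nat.strong_induction_on with
  | _ N ih =>
  intro m x hx
  rcases N with _ | N
  · simp only [SS, Finset.range_zero, Finset.sum_empty, sub_zero, pow_zero, one_mul, norm_pow]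
    calc ‖v x‖ ^ m ≤ R ^ m := by gcongr; exact hvR x hx
      _ ≤ R ^ m * Real.exp (m * x) := le_mul_of_one_le_right (by positivity)
          (Real.one_le_exp (mul_nonneg (by positivity) hx.1))
  have hvx : ∀ y ∈ Set.Icc 0 x, ‖v y‖ ≤ R := fun y hy => hvR y ⟨hy.1, hy.2.trans hx.2⟩
  obtain ⟨hi, hb⟩ := h.GG_int m hx (hK.continuousOn.mono (Set.Icc_subset_Icc_right hx.2)) hR hCR hvx
  have hi2 : IntervalIntegrable (fun s => (m : ℂ) * ∑ i ∈ Finset.range N,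
      a (i + 1) s * SS a (m + i + 1) (N - i) (v 0) s) volume 0 x := by
    refine IntervalIntegrable.const_mul ?_ _
    have := IntervalIntegrable.sum (Finset.range N)
      (fun i _ => h.intI i _ (h.cont_SS (m + i + 1) (N - i) (v 0)) hx)
    have e : (fun s => ∑ i ∈ Finset.range N, a (i + 1) s * SS a (m + i + 1) (N - i) (v 0) s) =
        ∑ i ∈ Finset.range N, fun s => a (i + 1) s * SS a (m + i + 1) (N - i) (v 0) s := by
      funext s; simp
    rw [e]
    exact this
  rw [h.sol_int m hv hx hR hCR hvx, h.SS_succ m N (v 0) hx, add_sub_add_left_eq_sub,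
    ← intervalIntegral.integral_sub (hi.const_mul _) hi2]
  have hE : ∫ s in (0 : ℝ)..x, q ^ (N + 1) * R ^ m * (m * Real.exp (m * s)) =
      q ^ (N + 1) * R ^ m * (Real.exp (m * x) - 1) := by
    rw [intervalIntegral.integral_const_mul]
    congr 1
    have := intervalIntegral.integral_eq_sub_of_hasDerivAt (a := 0) (b := x)
      (f := fun s => Real.exp (m * s)) (f' := fun s => m * Real.exp (m * s)) (fun s _ => by
        have := ((hasDerivAt_id s).const_mul (m : ℝ)).exp
        simpa [mul_comm] using this) (by apply Continuous.intervalIntegrable; fun_prop)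
    simpa using this
  have hbd : ∀ s ∈ Set.Ioc 0 x, ‖(m : ℂ) * GG a m v s - (m : ℂ) * ∑ i ∈ Finset.range N,
      a (i + 1) s * SS a (m + i + 1) (N - i) (v 0) s‖ ≤
      q ^ (N + 1) * R ^ m * (m * Real.exp (m * s)) := by
    intro s hs
    have hsT : s ∈ Set.Icc 0 T := ⟨hs.1.le, hs.2.trans hx.2⟩
    have s1 : HasSum (fun i : ℕ => a (i + 1) s * v s ^ (m + i + 1)) (GG a m v s) :=
      ((hb s hs).1.of_norm).hasSum
    have s2 : HasSum (fun i : ℕ => a (i + 1) s * SS a (m + i + 1) (N - i) (v 0) s)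
        (∑ i ∈ Finset.range N, a (i + 1) s * SS a (m + i + 1) (N - i) (v 0) s) := by
      apply hasSum_sum_of_ne_finset_zero
      intro i hi
      have : N - i = 0 := by simp at hi; omega
      simp [this, SS]
    have s3 := s1.sub s2
    have hs4 : HasSum (fun i : ℕ => q ^ (N + 1) * R ^ m * Real.exp (m * s) * (1 / 2 : ℝ) ^ (i + 1))
        (q ^ (N + 1) * R ^ m * Real.exp (m * s)) := by
      have := (hasSum_geometric_two.mul_left (q ^ (N + 1) * R ^ m * Real.exp (m * s) * (1 / 2)))
      have e : (fun i : ℕ => q ^ (N + 1) * R ^ m * Real.exp (m * s) * (1 / 2 : ℝ) ^ (i + 1)) =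
        fun i => q ^ (N + 1) * R ^ m * Real.exp (m * s) * (1 / 2) * (1 / 2) ^ i := by
        funext i; ring
      rw [e]
      have e2 : q ^ (N + 1) * R ^ m * Real.exp (m * s) * (1 / 2) * 2 =
        q ^ (N + 1) * R ^ m * Real.exp (m * s) := by ring
      rwa [e2] at this
    have hb5 := tsum_of_norm_bounded hs4 (f := fun i : ℕ => a (i + 1) s * v s ^ (m + i + 1) -
      a (i + 1) s * SS a (m + i + 1) (N - i) (v 0) s) (fun i => by
      rw [← mul_sub, norm_mul]
      have i1 := ih (N - i) (by omega) (m + i + 1) s hsT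
      have i2 := h.bd i s hsT
      have i3 : Real.exp (((m + i + 1 : ℕ) : ℝ) * s) ≤ Real.exp (m * s) * Real.exp T ^ (i + 1) := by
        rw [← Real.exp_nat_mul, ← Real.exp_add]
        apply Real.exp_le_exp.2
        push_cast
        have := mul_le_mul_of_nonneg_left hsT.2 (show (0 : ℝ) ≤ i + 1 by positivity)
        nlinarith
      calc ‖a (i + 1) s‖ * ‖v s ^ (m + i + 1) - SS a (m + i + 1) (N - i) (v 0) s‖
          ≤ C ^ (i + 1) * (q ^ (N - i) * R ^ (m + i + 1) *
            (Real.exp (m * s) * Real.exp T ^ (i + 1))) := by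
            gcongr
            exact i1.trans (by gcongr)
        _ = q ^ (i + 1 + (N - i)) * R ^ m * Real.exp (m * s) * (1 / 2 : ℝ) ^ (i + 1) := by
            have e1 : C ^ (i + 1) * R ^ (i + 1) * Real.exp T ^ (i + 1) =
              q ^ (i + 1) * (1 / 2 : ℝ) ^ (i + 1) := by
              rw [← mul_pow, ← mul_pow, ← mul_pow]; congr 1; rw [hqdef]; ring
            calc _ = (C ^ (i + 1) * R ^ (i + 1) * Real.exp T ^ (i + 1)) *
                  (q ^ (N - i) * R ^ m * Real.exp (m * s)) := by ring
              _ = _ := by rw [e1, pow_add]; ring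
        _ ≤ q ^ (N + 1) * R ^ m * Real.exp (m * s) * (1 / 2 : ℝ) ^ (i + 1) := by
            have : q ^ (i + 1 + (N - i)) ≤ q ^ (N + 1) :=
              pow_le_pow_of_le_one hq0 hq (by omega)
            gcongr)
    rw [s3.tsum_eq] at hb5
    rw [← mul_sub, norm_mul, Complex.norm_natCast]
    calc _ ≤ (m : ℝ) * (q ^ (N + 1) * R ^ m * Real.exp (m * s)) := by gcongr
      _ = _ := by ring
  refine (intervalIntegral.norm_integral_le_of_norm_le hx.1
    (Filter.Eventually.of_forall hbd) ?_).trans ?_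
  · apply Continuous.intervalIntegrable; fun_prop
  · rw [hE]
    gcongr
    linarith

lemma pow_sub_bd {R : ℝ} (hR : 0 ≤ R) {x y : ℂ} (hx : ‖x‖ ≤ R) (hy : ‖y‖ ≤ R) (n : ℕ) :
    ‖x ^ (n + 1) - y ^ (n + 1)‖ ≤ (n + 1) * R ^ n * ‖x - y‖ := by
  induction n with
  | zero => simp
  | succ n ih =>
    have e : x ^ (n + 1 + 1) - y ^ (n + 1 + 1) =
      x ^ (n + 1) * (x - y) + (x ^ (n + 1) - y ^ (n + 1)) * y := by ring
    rw [e]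
    calc _ ≤ ‖x‖ ^ (n + 1) * ‖x - y‖ + ‖x ^ (n + 1) - y ^ (n + 1)‖ * ‖y‖ := by
          refine (norm_add_le _ _).trans ?_
          rw [norm_mul, norm_mul, norm_pow]
      _ ≤ R ^ (n + 1) * ‖x - y‖ + ((n + 1) * R ^ n * ‖x - y‖) * R := by gcongr
      _ = _ := by push_cast; ring

lemma Bd.GG_lip {T C : ℝ} {a : ℕ → ℝ → ℂ} (h : Bd T C a) {w u : ℝ → ℂ} {s R : ℝ}
    (hs : s ∈ Set.Icc 0 T) (hR : 0 ≤ R) (hCR : 4 * C * R ≤ 1)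
    (hw : ‖w s‖ ≤ R) (hu : ‖u s‖ ≤ R)
    (sw : Summable (fun i => ‖a (i + 1) s * w s ^ (1 + i + 1)‖))
    (su : Summable (fun i => ‖a (i + 1) s * u s ^ (1 + i + 1)‖)) :
    ‖GG a 1 w s - GG a 1 u s‖ ≤ 4 * C * R * ‖w s - u s‖ := by
  have hC := h.hC
  unfold GG
  rw [← sw.of_norm.tsum_sub su.of_norm]
  set B := 4 * C * R * ‖w s - u s‖ with hB
  have hsum : HasSum (fun i : ℕ => B * (1 / 2 : ℝ) ^ (i + 1)) B := by
    have := (hasSum_geometric_two.mul_left (B * (1 / 2)))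
    have e : (fun i : ℕ => B * (1 / 2 : ℝ) ^ (i + 1)) = fun i => B * (1 / 2) * (1 / 2) ^ i := by
      funext i; ring
    rw [e]
    have e2 : B * (1 / 2) * 2 = B := by ring
    rwa [e2] at this
  refine tsum_of_norm_bounded hsum fun i => ?_
  rw [← mul_sub, norm_mul]
  have h2 : ((i : ℝ) + 2) ≤ 2 ^ (i + 1) := by
    have : i + 1 < 2 ^ (i + 1) := Nat.lt_two_pow_self
    have : i + 2 ≤ 2 ^ (i + 1) := this
    exact_mod_cast this
  calc ‖a (i + 1) s‖ * ‖w s ^ (1 + i + 1) - u s ^ (1 + i + 1)‖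
      ≤ C ^ (i + 1) * (((1 + i : ℕ) + 1) * R ^ (1 + i) * ‖w s - u s‖) := by
        gcongr
        · exact h.bd i s hs
        · exact pow_sub_bd hR hw hu (1 + i)
    _ = C ^ (i + 1) * (((i : ℝ) + 2) * R ^ (i + 1) * ‖w s - u s‖) := by
        push_cast; rw [add_comm 1 i]; ring
    _ ≤ C ^ (i + 1) * (2 ^ (i + 1) * R ^ (i + 1) * ‖w s - u s‖) := by gcongr
    _ = (4 * C * R) ^ (i + 1) * ‖w s - u s‖ * (1 / 2) ^ (i + 1) := by
        have e1 : (2 * C * R) ^ (i + 1) = (4 * C * R) ^ (i + 1) * (1 / 2) ^ (i + 1) := by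
          rw [← mul_pow]; congr 1; ring
        rw [mul_right_comm ((4 * C * R) ^ (i + 1)), ← e1, mul_pow, mul_pow]; ring
    _ ≤ B * (1 / 2) ^ (i + 1) := by
        rw [hB]
        gcongr
        exact pow_le_of_le_one (by positivity) hCR (by omega)

lemma Bd.exists_sol {T C : ℝ} {a : ℕ → ℝ → ℂ} (h : Bd T C a) {R : ℝ} (hR : 0 < R)
    (hCR : 4 * C * R ≤ 1) (hTR : 2 * C * R * T ≤ 1 / 4) (v0 : ℂ) (hv0 : ‖v0‖ ≤ R / 2) :
    ∃ v, IsODESol T a v ∧ v 0 = v0 := by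
  have hC := h.hC
  have hT := h.hT
  have hCR' : 2 * C * R ≤ 1 := by nlinarith [mul_pos hC hR]
  have hTT : T ∈ Set.Icc 0 T := ⟨hT, le_rfl⟩
  let α := Metric.closedBall (0 : C(Set.Icc (0 : ℝ) T, ℂ)) R
  have hcs : CompleteSpace α := Metric.isClosed_closedBall.completeSpace_coe
  let W : α → ℝ → ℂ := fun u => Set.IccExtend hT u.1
  have hWc : ∀ u, Continuous (W u) := fun u => u.1.continuous.Icc_extend'
  have hWR : ∀ u s, ‖W u s‖ ≤ R := by
    intro u s
    have := mem_closedBall_zero_iff.1 u.2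
    exact (u.1.norm_coe_le_norm _).trans this
  have hG : ∀ u, IntervalIntegrable (GG a 1 (W u)) volume 0 T ∧ ∀ x ∈ Set.Ioc 0 T,
      Summable (fun i => ‖a (i + 1) x * W u x ^ (1 + i + 1)‖) ∧
        ‖GG a 1 (W u) x‖ ≤ R ^ 1 * (2 * C * R) :=
    fun u => h.GG_int 1 hTT (hWc u).continuousOn hR.le hCR' (fun x _ => hWR u x)
  have hGx : ∀ u, ∀ x ∈ Set.Icc 0 T, IntervalIntegrable (GG a 1 (W u)) volume 0 x := by
    intro u x hx
    refine (hG u).1.mono_set ?_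
    rw [Set.uIcc_of_le hT, Set.uIcc_of_le hx.1]; exact Set.Icc_subset_Icc_right hx.2
  have hcont : ∀ u, ContinuousOn (fun x => v0 + ∫ s in (0 : ℝ)..x, GG a 1 (W u) s) (Set.Icc 0 T) := by
    intro u
    have := intervalIntegral.continuousOn_primitive_interval' (hG u).1 (a := 0) (by simp)
    rw [Set.uIcc_of_le hT] at this
    exact continuousOn_const.add this
  let Ψ : α → C(Set.Icc (0 : ℝ) T, ℂ) := fun u =>
    ⟨fun x => v0 + ∫ s in (0 : ℝ)..x, GG a 1 (W u) s, (continuousOn_iff_continuous_domRestrict.1 (hcont u))⟩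
  have hΨ : ∀ u, Ψ u ∈ Metric.closedBall (0 : C(Set.Icc (0 : ℝ) T, ℂ)) R := by
    intro u
    rw [mem_closedBall_zero_iff, ContinuousMap.norm_le _ hR.le]
    intro x
    have n1 : ‖∫ s in (0 : ℝ)..x, GG a 1 (W u) s‖ ≤ R ^ 1 * (2 * C * R) * |(x : ℝ) - 0| := by
      refine intervalIntegral.norm_integral_le_of_norm_le_const fun s hs => ?_
      rw [Set.uIoc_of_le x.2.1] at hs
      exact ((hG u).2 s ⟨hs.1, hs.2.trans x.2.2⟩).2
    rw [sub_zero, abs_of_nonneg x.2.1] at n1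
    have n2 : R ^ 1 * (2 * C * R) * x ≤ R * (1 / 4) := by
      calc R ^ 1 * (2 * C * R) * x ≤ R ^ 1 * (2 * C * R) * T := by gcongr; exact x.2.2
        _ = R * (2 * C * R * T) := by ring
        _ ≤ _ := by gcongr
    have n3 := norm_add_le v0 (∫ s in (0 : ℝ)..x, GG a 1 (W u) s)
    change ‖v0 + ∫ s in (0 : ℝ)..x, GG a 1 (W u) s‖ ≤ R
    linarith
  let Φ : α → α := fun u => ⟨Ψ u, hΨ u⟩
  have hcontr : ContractingWith (1 / 2 : NNReal) Φ := by
    refine ⟨by rw [div_lt_one] <;> norm_num, LipschitzWith.of_dist_le_mul fun u w => ?_⟩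
    rw [Subtype.dist_eq, Subtype.dist_eq]
    rw [ContinuousMap.dist_le (by positivity)]
    intro x
    change dist (v0 + ∫ s in (0 : ℝ)..x, GG a 1 (W u) s) (v0 + ∫ s in (0 : ℝ)..x, GG a 1 (W w) s) ≤ _
    rw [dist_add_left, dist_eq_norm, ← intervalIntegral.integral_sub (hGx u x x.2) (hGx w x x.2)]
    have n1 : ‖∫ s in (0 : ℝ)..x, GG a 1 (W u) s - GG a 1 (W w) s‖ ≤
        4 * C * R * dist u.1 w.1 * |(x : ℝ) - 0| := by
      refine intervalIntegral.norm_integral_le_of_norm_le_const fun s hs => ?_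
      rw [Set.uIoc_of_le x.2.1] at hs
      have hs' : s ∈ Set.Ioc 0 T := ⟨hs.1, hs.2.trans x.2.2⟩
      refine (h.GG_lip ⟨hs'.1.le, hs'.2⟩ hR.le hCR (hWR u s) (hWR w s)
        ((hG u).2 s hs').1 ((hG w).2 s hs').1).trans ?_
      gcongr
      rw [← dist_eq_norm]
      exact ContinuousMap.dist_apply_le_dist _
    rw [sub_zero, abs_of_nonneg x.2.1] at n1
    refine n1.trans ?_
    calc 4 * C * R * dist u.1 w.1 * x ≤ 4 * C * R * dist u.1 w.1 * T := by gcongr; exact x.2.2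
      _ = 2 * (2 * C * R * T) * dist u.1 w.1 := by ring
      _ ≤ 2 * (1 / 4) * dist u.1 w.1 := by gcongr
      _ = ((1 / 2 : NNReal) : ℝ) * dist u.1 w.1 := by push_cast; ring
  let u0 : α := ⟨0, Metric.mem_closedBall_self hR.le⟩
  obtain ⟨u, hu, -⟩ := hcontr.exists_fixedPoint u0 (edist_ne_top _ _)
  have hfix : ∀ x ∈ Set.Icc 0 T, W u x = v0 + ∫ s in (0 : ℝ)..x, GG a 1 (W u) s := by
    intro x hx
    have e1 : Ψ u = u.1 := congrArg Subtype.val hu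
    have e2 : W u x = u.1 ⟨x, hx⟩ := Set.IccExtend_of_mem hT _ hx
    rw [e2, ← e1]
    rfl
  refine ⟨fun x => v0 + ∫ s in (0 : ℝ)..x, GG a 1 (W u) s, ⟨⟨(R ^ 1 * (2 * C * R)).toNNReal, ?_⟩, ?_⟩, by simp⟩
  · have := lip_prim (hG u).1 (fun x hx => ((hG u).2 x hx).2) (by positivity)
    intro x hx y hy
    rw [edist_add_left]
    exact this hx hy
  · rw [← Measure.restrict_congr_set Ioc_ae_eq_Icc, ae_restrict_iff' measurableSet_Ioc]
    filter_upwards [(hG u).1.ae_hasDerivAt_integral] with x hx hxT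
    have hxT' : x ∈ Set.Icc 0 T := ⟨hxT.1.le, hxT.2⟩
    have h1 := hx (by rwa [Set.uIcc_of_le hT]) 0 (by simp)
    have e : ∀ i : ℕ, i + 2 = 1 + i + 1 := fun i => by ring
    simp only [e]
    rw [← hfix x hxT']
    refine ⟨((hG u).2 x hxT).1, ?_⟩
    exact h1.const_add v0

lemma SS_one {T : ℝ} {a : ℕ → ℝ → ℂ} (N : ℕ) (r : ℂ)
    (hz : ∀ j, 1 ≤ j → j < N + 1 → cc a 1 j T = 0) : SS a 1 (N + 1) r T = r := by
  rw [SS, Finset.sum_range_succ', cc_zero, Finset.sum_eq_zero]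
  · simp
  · intro j hj
    rw [hz (j + 1) (by omega) (by simp at hj; omega), zero_mul]

lemma Bd.small {T C : ℝ} {a : ℕ → ℝ → ℂ} (h : Bd T C a) {R : ℝ} (hR : 0 < R)
    (hk : 8 * C * R * Real.exp T ≤ 1) :
    4 * C * R ≤ 1 ∧ 2 * C * R ≤ 1 ∧ 2 * C * R * T ≤ 1 / 4 ∧ 2 * C * R * Real.exp T ≤ 1 / 4 := by
  have hCR : 0 < C * R := mul_pos h.hC hR
  have e1 : 1 ≤ Real.exp T := Real.one_le_exp h.hT
  have e2 : T ≤ Real.exp T := by linarith [Real.add_one_le_exp T]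
  have f1 := mul_le_mul_of_nonneg_left e1 hCR.le
  have f2 := mul_le_mul_of_nonneg_left e2 hCR.le
  refine ⟨?_, ?_, ?_, ?_⟩ <;> nlinarith

lemma Bd.center_iff {T C : ℝ} {a : ℕ → ℝ → ℂ} (h : Bd T C a) :
    IsCenter T a ↔ ∀ n : ℕ, 1 ≤ n → cc a 1 n T = 0 := by
  have hC := h.hC
  have hTT : T ∈ Set.Icc 0 T := ⟨h.hT, le_rfl⟩
  set E := Real.exp T with hE
  have hE0 : 0 < E := Real.exp_pos T
  set R0 := 1 / (8 * C * E) with hR0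
  have hR0p : 0 < R0 := by positivity
  have hR0k : 8 * C * R0 * E ≤ 1 := by
    rw [hR0]; apply le_of_eq; field_simp
  constructor
  · rintro ⟨ε, hε, hcen⟩ n
    induction n using Nat.strong_induction_on with
    | _ n ih =>
    intro hn
    by_contra hne
    set δ := ‖cc a 1 n T‖ with hδ
    have hδ0 : 0 < δ := norm_pos_iff.2 hne
    set M := (4 * C * E) ^ (n + 1) * E with hM
    have hM0 : 0 < M := by positivity
    set R := min (min R0 ε) (δ / (2 * M)) with hRdef
    have hR : 0 < R := by positivity
    have hRR0 : R ≤ R0 := (min_le_left _ _).trans (min_le_left _ _)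
    have hRε : R ≤ ε := (min_le_left _ _).trans (min_le_right _ _)
    have hRδ : R ≤ δ / (2 * M) := min_le_right _ _
    have hk : 8 * C * R * E ≤ 1 := le_trans (by gcongr) hR0k
    obtain ⟨k1, k2, k3, k4⟩ := h.small hR hk
    have hn0 : ‖((R / 2 : ℝ) : ℂ)‖ = R / 2 := by
      rw [Complex.norm_real, Real.norm_of_nonneg (by positivity)]
    obtain ⟨v, hv, hv0⟩ := h.exists_sol hR k1 k3 ((R / 2 : ℝ) : ℂ) hn0.le
    have hnv : ‖v 0‖ = R / 2 := by rw [hv0, hn0]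
    have hvT := hcen v (by rw [hnv]; linarith) hv
    have hap := h.apriori hv hR k2 k3 hnv.le
    have hb := h.main_bound hv hR.le (by linarith) hap (n + 1) 1 T hTT
    obtain ⟨p, rfl⟩ : ∃ p, n = p + 1 := ⟨n - 1, by omega⟩
    have hS : SS a 1 (p + 1 + 1) (v 0) T = v 0 + cc a 1 (p + 1) T * v 0 ^ (p + 1 + 1) := by
      have := SS_one (T := T) (a := a) p (v 0) (fun j h1 h2 => ih j h2 h1)
      rw [SS, Finset.sum_range_succ, ← SS, this]
    rw [hS, pow_one, hvT, sub_add_cancel_left, norm_neg, norm_mul, norm_pow, hnv, pow_one,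
      Nat.cast_one, one_mul, ← hδ, ← hE] at hb
    have hb2 : δ ≤ M * R := by
      have hp : 0 < (R / 2) ^ (p + 1 + 1) := by positivity
      refine le_of_mul_le_mul_right (hb.trans (le_of_eq ?_)) hp
      have : (2 * C * R * E) ^ (p + 1 + 1) = (4 * C * E) ^ (p + 1 + 1) * (R / 2) ^ (p + 1 + 1) := by
        rw [← mul_pow]; congr 1; ring
      rw [this, hM]; ring
    have hb3 : M * R ≤ δ / 2 := by
      calc M * R ≤ M * (δ / (2 * M)) := by gcongr
        _ = δ / 2 := by field_simp
    linarith
  · intro hz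
    obtain ⟨k1, k2, k3, k4⟩ := h.small hR0p hR0k
    refine ⟨R0 / 2, by positivity, fun v hv0 hv => ?_⟩
    have hap := h.apriori hv hR0p k2 k3 hv0.le
    have hb : ∀ N : ℕ, ‖v T - v 0‖ ≤ (1 / 4) ^ (N + 1) * (R0 * E) := by
      intro N
      have := h.main_bound hv hR0p.le (by linarith) hap (N + 1) 1 T hTT
      rw [SS_one N (v 0) (fun j h1 _ => hz j h1), pow_one, pow_one, Nat.cast_one, one_mul,
        mul_assoc] at this
      refine this.trans ?_
      gcongr
    have hlim : Filter.Tendsto (fun N : ℕ => (1 / 4 : ℝ) ^ (N + 1) * (R0 * E)) Filter.atTop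
        (nhds (0 * (R0 * E))) :=
      ((tendsto_pow_atTop_nhds_zero_of_lt_one (by norm_num) (by norm_num)).comp
        (Filter.tendsto_add_atTop_nat 1)).mul_const _
    have := ge_of_tendsto' hlim hb
    rw [zero_mul] at this
    exact sub_eq_zero.1 (norm_le_zero_iff.1 this)

/-- center criterion, evaluated form: `a ∈ X` determines a center iff
`∑_{i₁+⋯+iₖ=i} p_{i₁,…,iₖ}(i) · I_{i₁,…,iₖ}(a) = 0` for every `i ≥ 1`, the sum over all
multi-indices of positive integers with `i₁+⋯+iₖ = i` (i.e. compositions of `i`). -/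
theorem center_iff_evaluated (T : ℝ) (hT : 0 < T) (a : ℕ → ℝ → ℂ) (ha : MemX T a) :
    IsCenter T a ↔ ∀ i : ℕ, 1 ≤ i →
      ∑ comp : Composition i, pval comp.blocks (i : ℂ) * itInt T a comp.blocks = 0 := by
  obtain ⟨hm, C, hC⟩ := ha
  have h : Bd T (|C| + 1) a := ⟨hT.le, by positivity, hm, fun i x hx =>
    (hC (i + 1) (by omega) x hx).trans ((le_abs_self _).trans (by
      rw [abs_pow]; gcongr; linarith))⟩
  rw [h.center_iff]
  simp only [sum_eq_cc]
end
end
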